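/- arXiv:1903.03541 — 2 statements merged into one kernel-verified Lean document; each statement's English description precedes it below -/
import Mathlib

section
/- Let N and N' be finite linear spaces with a common subset Y on which they induce the same structure, N = Y ∪ A and N' = Y ∪ A' with A ∩ Y = A' ∩ Y = ∅. Suppose A is 0-primitive over Y in N and A' is 0-primitive over Y in N', both based on the same B ⊆ Y (i.e., (B, A) and (B, A') are good pairs), and suppose f : B ∪ A → B ∪ A' is an isomorphism of the induced linear spaces fixing B pointwise. Then the map that is the identity on Y and agrees with f on A is an isomorphism of linear spaces from N onto N'. -/
open scoped Classical

/-- A (one-sorted) linear space: a ternary collinearity relation that holds only of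
pairwise distinct triples, is invariant under all permutations of its arguments, and
satisfies that two points determine at most one line. -/
structure IsLinearSpace {M : Type*} (R : M → M → M → Prop) : Prop where
  ne12 : ∀ {a b c : M}, R a b c → a ≠ b
  ne23 : ∀ {a b c : M}, R a b c → b ≠ c
  ne13 : ∀ {a b c : M}, R a b c → a ≠ c
  swap12 : ∀ {a b c : M}, R a b c → R b a c
  swap23 : ∀ {a b c : M}, R a b c → R a c b
  line : ∀ {x y z w : M}, R x y z → R x y w → z ≠ w → R x w z

/-- `X` is an `R`-clique: every three pairwise distinct elements of `X` satisfy `R`. -/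
def FinClique {M : Type*} (R : M → M → M → Prop) (X : Finset M) : Prop :=
  ∀ a ∈ X, ∀ b ∈ X, ∀ c ∈ X, a ≠ b → b ≠ c → a ≠ c → R a b c

/-- `ℓ` is a nontrivial line of the induced structure on `A`:
a maximal `R`-clique of `A` of size at least 3. -/
def IsLineOf {M : Type*} (R : M → M → M → Prop) (A ℓ : Finset M) : Prop :=
  ℓ ⊆ A ∧ 3 ≤ ℓ.card ∧ FinClique R ℓ ∧
    ∀ ℓ' : Finset M, ℓ' ⊆ A → FinClique R ℓ' → ℓ ⊆ ℓ' → ℓ' = ℓ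

/-- The (finite) set of nontrivial lines of the induced structure on `A`. -/
noncomputable def linesOf {M : Type*} (R : M → M → M → Prop) (A : Finset M) :
    Finset (Finset M) :=
  A.powerset.filter fun ℓ => IsLineOf R A ℓ

/-- The predimension `δ(A) = |A| - Σ_{ℓ ∈ L(A)} (|ℓ| - 2)`. -/
noncomputable def delta {M : Type*} (R : M → M → M → Prop) (A : Finset M) : ℤ :=
  (A.card : ℤ) - ∑ ℓ ∈ linesOf R A, ((ℓ.card : ℤ) - 2)

/-- Membership in the class `K₀`: all subsets have nonnegative predimension. -/
def InK0 {M : Type*} (R : M → M → M → Prop) (A : Finset M) : Prop :=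
  ∀ A' ⊆ A, 0 ≤ delta R A'

/-- `A ≤ B`: `A` is a strong substructure of `B`. -/
def Strong {M : Type*} (R : M → M → M → Prop) (A B : Finset M) : Prop :=
  A ⊆ B ∧ ∀ X : Finset M, A ⊆ X → X ⊆ B → delta R A ≤ delta R X

/-- `C` is a primitive extension of `B`. -/
def PrimitiveExt {M : Type*} (R : M → M → M → Prop) (B C : Finset M) : Prop :=
  Strong R B C ∧ ¬ ∃ A₀ : Finset M, B ⊂ A₀ ∧ A₀ ⊂ C ∧ Strong R B A₀ ∧ Strong R A₀ C

/-- `A` is `0`-primitive over `B` (with `A` the set of new points, disjoint from `B`). -/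
def ZeroPrimOver {M : Type*} (R : M → M → M → Prop) (B A : Finset M) : Prop :=
  Disjoint B A ∧ A.Nonempty ∧ PrimitiveExt R B (B ∪ A) ∧ delta R (B ∪ A) = delta R B

/-- `(B, A)` is a good pair. -/
def GoodPair {M : Type*} (R : M → M → M → Prop) (B A : Finset M) : Prop :=
  ZeroPrimOver R B A ∧ ∀ B' : Finset M, B' ⊂ B → ¬ ZeroPrimOver R B' A

/-- The trace on `X` of the line through `p` and `q`. -/
noncomputable def lineThrough {M : Type*} (R : M → M → M → Prop) (X : Finset M) (p q : M) :
    Finset M :=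
  X.filter fun z => z = p ∨ z = q ∨ R p q z

section LinearSpace

variable {M : Type*} {R : M → M → M → Prop}

theorem IsLinearSpace.of_collinear (h : IsLinearSpace R) {p q x y z : M} (hpq : p ≠ q)
    (hx : x = p ∨ x = q ∨ R p q x) (hy : y = p ∨ y = q ∨ R p q y)
    (hz : z = p ∨ z = q ∨ R p q z) (hxy : x ≠ y) (hyz : y ≠ z) (hxz : x ≠ z) :
    R x y z := by
  have s1 := @h.swap12
  have s2 := @h.swap23
  have base : ∀ {u v : M}, R p q u → R p q v → u ≠ v → R p u v :=
    fun hu hv huv => h.line hv hu huv.symm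
  have base' : ∀ {u v : M}, R p q u → R p q v → u ≠ v → R q u v :=
    fun hu hv huv => h.line (h.swap12 hv) (h.swap12 hu) huv.symm
  rcases hx with rfl | rfl | hx <;> rcases hy with rfl | rfl | hy <;>
    rcases hz with rfl | rfl | hz <;> try first | contradiction | grind
  exact s2 (h.line (s1 (base hx hy hxy)) (s1 (base hx hz hxz)) hyz)

theorem mem_lineThrough {X : Finset M} {p q z : M} :
    z ∈ lineThrough R X p q ↔ z ∈ X ∧ (z = p ∨ z = q ∨ R p q z) := by
  simp [lineThrough]

theorem lineThrough_inter {X N : Finset M} (hX : X ⊆ N) (p q : M) :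
    lineThrough R N p q ∩ X = lineThrough R X p q := by
  ext z
  simp only [Finset.mem_inter, mem_lineThrough]
  have := @hX z
  tauto

theorem IsLinearSpace.finClique_lineThrough (h : IsLinearSpace R) (X : Finset M) {p q : M}
    (hpq : p ≠ q) : FinClique R (lineThrough R X p q) := by
  intro a ha b hb c hc hab hbc hac
  rw [mem_lineThrough] at ha hb hc
  exact h.of_collinear hpq ha.2 hb.2 hc.2 hab hbc hac

theorem FinClique.subset_lineThrough {X l : Finset M} (hl : FinClique R l) (hX : l ⊆ X)
    {p q : M} (hp : p ∈ l) (hq : q ∈ l) (hpq : p ≠ q) : l ⊆ lineThrough R X p q := by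
  intro z hz
  rw [mem_lineThrough]
  refine ⟨hX hz, ?_⟩
  by_cases h1 : z = p
  · exact Or.inl h1
  by_cases h2 : z = q
  · exact Or.inr (Or.inl h2)
  exact Or.inr (Or.inr (hl p hp q hq z hz hpq (Ne.symm h2) (Ne.symm h1)))

theorem mem_linesOf {X l : Finset M} : l ∈ linesOf R X ↔ IsLineOf R X l := by
  simp only [linesOf, Finset.mem_filter, Finset.mem_powerset]
  exact ⟨fun h => h.2, fun h => ⟨h.1, h⟩⟩

theorem IsLinearSpace.eq_lineThrough (h : IsLinearSpace R) {X l : Finset M}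
    (hl : l ∈ linesOf R X) {p q : M} (hp : p ∈ l) (hq : q ∈ l) (hpq : p ≠ q) :
    l = lineThrough R X p q := by
  obtain ⟨hlX, -, hcl, hmax⟩ := mem_linesOf.1 hl
  exact (hmax _ (Finset.filter_subset _ _) (h.finClique_lineThrough X hpq)
    (hcl.subset_lineThrough hlX hp hq hpq)).symm

theorem IsLinearSpace.lineThrough_mem_linesOf (h : IsLinearSpace R) {X : Finset M} {p q : M}
    (hp : p ∈ X) (hq : q ∈ X) (hpq : p ≠ q) (hc : 3 ≤ (lineThrough R X p q).card) :
    lineThrough R X p q ∈ linesOf R X := by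
  refine mem_linesOf.2 ⟨Finset.filter_subset _ _, hc, h.finClique_lineThrough X hpq, ?_⟩
  intro l' hl' hcl hsub
  exact Finset.Subset.antisymm
    (hcl.subset_lineThrough hl' (hsub (mem_lineThrough.2 ⟨hp, Or.inl rfl⟩))
      (hsub (mem_lineThrough.2 ⟨hq, Or.inr (Or.inl rfl)⟩)) hpq) hsub

/-- The predimension of a subset, computed from the lines of a larger set. -/
theorem IsLinearSpace.delta_eq (h : IsLinearSpace R) {X N : Finset M} (hX : X ⊆ N) :
    delta R X = (X.card : ℤ) - ∑ l ∈ linesOf R N, (((l ∩ X).card - 2 : ℕ) : ℤ) := by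
  have key : ∑ l ∈ (linesOf R N).filter (fun l => 3 ≤ (l ∩ X).card),
      (((l ∩ X).card - 2 : ℕ) : ℤ) = ∑ l ∈ linesOf R X, ((l.card : ℤ) - 2) := by
    refine Finset.sum_bij (fun l _ => l ∩ X) ?_ ?_ ?_ ?_
    · intro l hl
      obtain ⟨hl, hc⟩ := Finset.mem_filter.1 hl
      obtain ⟨p, hp, q, hq, hpq⟩ := Finset.one_lt_card.1 (show 1 < (l ∩ X).card by omega)
      rw [Finset.mem_inter] at hp hq
      have e := h.eq_lineThrough hl hp.1 hq.1 hpq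
      have e' : l ∩ X = lineThrough R X p q := by
        conv_lhs => rw [e]
        exact lineThrough_inter hX p q
      change l ∩ X ∈ _
      rw [e'] at hc ⊢
      exact h.lineThrough_mem_linesOf hp.2 hq.2 hpq hc
    · intro l hl l' hl' hll
      obtain ⟨hl, hc⟩ := Finset.mem_filter.1 hl
      obtain ⟨hl', -⟩ := Finset.mem_filter.1 hl'
      replace hll : l ∩ X = l' ∩ X := hll
      obtain ⟨p, hp, q, hq, hpq⟩ := Finset.one_lt_card.1 (show 1 < (l ∩ X).card by omega)
      have hp' := hll ▸ hp
      have hq' := hll ▸ hq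
      rw [Finset.mem_inter] at hp hq hp' hq'
      rw [h.eq_lineThrough hl hp.1 hq.1 hpq, h.eq_lineThrough hl' hp'.1 hq'.1 hpq]
    · intro l hl
      obtain ⟨hlX, hc, -, -⟩ := mem_linesOf.1 hl
      obtain ⟨p, hp, q, hq, hpq⟩ := Finset.one_lt_card.1 (show 1 < l.card by omega)
      have e := h.eq_lineThrough hl hp hq hpq
      have e' := lineThrough_inter (R := R) hX p q
      rw [← e] at e'
      have hle : l.card ≤ (lineThrough R N p q).card := by
        conv_lhs => rw [← e']
        exact Finset.card_le_card Finset.inter_subset_left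
      refine ⟨lineThrough R N p q, Finset.mem_filter.2
        ⟨h.lineThrough_mem_linesOf (hX (hlX hp)) (hX (hlX hq)) hpq (by omega), ?_⟩, e'⟩
      rw [e']
      exact hc
    · intro l hl
      have hc := (Finset.mem_filter.1 hl).2
      push_cast [show 2 ≤ (l ∩ X).card by omega]
      rfl
  rw [delta, ← key, Finset.sum_filter_of_ne]
  intro l _ hne
  by_contra hlt
  exact hne (by rw [show (l ∩ X).card - 2 = 0 by omega]; rfl)

/-- If adding `A` to `B` and to `Y ⊇ B` changes the predimension by the same amount, then every
line meeting both `A` and `Y \ B` contains two points of `B`. -/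
theorem IsLinearSpace.exists_base_points (h : IsLinearSpace R) {Y A B : Finset M}
    (hYA : Disjoint Y A) (hB : B ⊆ Y)
    (hδ : delta R (Y ∪ A) - delta R Y = delta R (B ∪ A) - delta R B)
    {x y z : M} (hx : x ∈ A) (hy : y ∈ Y) (hyB : y ∉ B) (hz : z ∈ Y ∪ A) (hR : R x y z) :
    ∃ b ∈ B, ∃ c ∈ B, b ≠ c ∧ R b c x ∧ R b c y ∧ (z = b ∨ z = c ∨ R b c z) := by
  have hBA : Disjoint B A := hYA.mono_left hB
  have hx' : x ∈ Y ∪ A := Finset.mem_union_right _ hx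
  have hy' : y ∈ Y ∪ A := Finset.mem_union_left _ hy
  have hxB : x ∉ B := fun hxB => Finset.disjoint_left.1 hBA hxB hx
  have hcards : ∀ l : Finset M,
      (l ∩ (Y ∪ A)).card = (l ∩ B).card + (l ∩ (Y \ B)).card + (l ∩ A).card ∧
      (l ∩ Y).card = (l ∩ B).card + (l ∩ (Y \ B)).card ∧
      (l ∩ (B ∪ A)).card = (l ∩ B).card + (l ∩ A).card := by
    intro l
    have hunion : ∀ {U V : Finset M}, Disjoint U V →
        (l ∩ (U ∪ V)).card = (l ∩ U).card + (l ∩ V).card := by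
      intro U V hUV
      rw [Finset.inter_union_distrib_left]
      exact Finset.card_union_of_disjoint
        (hUV.mono Finset.inter_subset_right Finset.inter_subset_right)
    have h1 := hunion hYA
    have h2 := hunion hBA
    have h3 := hunion (Finset.disjoint_sdiff (s := B) (t := Y))
    rw [Finset.union_sdiff_of_subset hB] at h3
    omega
  have hsum : ∑ l ∈ linesOf R (Y ∪ A),
      ((((l ∩ (Y ∪ A)).card - 2 : ℕ) : ℤ) - ((l ∩ Y).card - 2 : ℕ) -
        ((l ∩ (B ∪ A)).card - 2 : ℕ) + ((l ∩ B).card - 2 : ℕ)) = 0 := by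
    simp only [Finset.sum_add_distrib, Finset.sum_sub_distrib]
    rw [h.delta_eq (Finset.Subset.refl (Y ∪ A)),
      h.delta_eq (N := Y ∪ A) Finset.subset_union_left,
      h.delta_eq (N := Y ∪ A) (Finset.union_subset_union_left hB),
      h.delta_eq (N := Y ∪ A) (hB.trans Finset.subset_union_left),
      Finset.card_union_of_disjoint hYA, Finset.card_union_of_disjoint hBA] at hδ
    push_cast at hδ ⊢
    linarith
  rw [Finset.sum_eq_zero_iff_of_nonneg (by
    intro l _
    have := hcards l
    omega)] at hsum
  set l := lineThrough R (Y ∪ A) x y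
  have hxl : x ∈ l := mem_lineThrough.2 ⟨hx', Or.inl rfl⟩
  have hyl : y ∈ l := mem_lineThrough.2 ⟨hy', Or.inr (Or.inl rfl)⟩
  have hzl : z ∈ l := mem_lineThrough.2 ⟨hz, Or.inr (Or.inr hR)⟩
  have hcl : FinClique R l := h.finClique_lineThrough _ (h.ne12 hR)
  have hsub : l ⊆ Y ∪ A := Finset.filter_subset _ _
  have h3 : 3 ≤ l.card := by
    rw [← Finset.card_eq_three.2 ⟨x, y, z, h.ne12 hR, h.ne13 hR, h.ne23 hR, rfl⟩]
    apply Finset.card_le_card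
    intro w hw
    simp only [Finset.mem_insert, Finset.mem_singleton] at hw
    rcases hw with rfl | rfl | rfl <;> assumption
  have h0 := hsum l (h.lineThrough_mem_linesOf hx' hy' (h.ne12 hR) h3)
  have hA : 0 < (l ∩ A).card := Finset.card_pos.2 ⟨x, Finset.mem_inter.2 ⟨hxl, hx⟩⟩
  have hYB : 0 < (l ∩ (Y \ B)).card :=
    Finset.card_pos.2 ⟨y, Finset.mem_inter.2 ⟨hyl, Finset.mem_sdiff.2 ⟨hy, hyB⟩⟩⟩
  have hc := hcards l
  have hlN : l ∩ (Y ∪ A) = l := Finset.inter_eq_left.2 hsub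
  have hlN' : (l ∩ (Y ∪ A)).card = l.card := by rw [hlN]
  obtain ⟨b, hb, c, hc, hbc⟩ := Finset.one_lt_card.1 (show 1 < (l ∩ B).card by omega)
  rw [Finset.mem_inter] at hb hc
  have hne : ∀ {u v : M}, u ∈ B → v ∉ B → u ≠ v := fun hu hv huv => hv (huv ▸ hu)
  refine ⟨b, hb.2, c, hc.2, hbc,
    hcl b hb.1 c hc.1 x hxl hbc (hne hc.2 hxB) (hne hb.2 hxB),
    hcl b hb.1 c hc.1 y hyl hbc (hne hc.2 hyB) (hne hb.2 hyB), ?_⟩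
  exact (mem_lineThrough.1 (hcl.subset_lineThrough hsub hb.1 hc.1 hbc hzl)).2

/-- Collinearity on `Y ∪ A` transfers to another linear space agreeing on `Y` and on `B ∪ A`,
provided that every line meeting both `A` and `Y \ B` contains two points of `B`. -/
theorem IsLinearSpace.transfer_of_exists_base_points {T : M → M → M → Prop}
    (hR : IsLinearSpace R) (hT : IsLinearSpace T) {Y A B : Finset M} (hB : B ⊆ Y)
    (hY : ∀ x ∈ Y, ∀ y ∈ Y, ∀ z ∈ Y, R x y z → T x y z)
    (hBA : ∀ x ∈ B ∪ A, ∀ y ∈ B ∪ A, ∀ z ∈ B ∪ A, R x y z → T x y z)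
    (hbase : ∀ x ∈ A, ∀ y ∈ Y, y ∉ B → ∀ z ∈ Y ∪ A, R x y z →
      ∃ b ∈ B, ∃ c ∈ B, b ≠ c ∧ R b c x ∧ R b c y ∧ (z = b ∨ z = c ∨ R b c z))
    {x y z : M} (hx : x ∈ Y ∪ A) (hy : y ∈ Y ∪ A) (hz : z ∈ Y ∪ A) (h : R x y z) :
    T x y z := by
  have mixed : ∀ x ∈ A, ∀ y ∈ Y, y ∉ B → ∀ z ∈ Y ∪ A, R x y z → T x y z := by
    intro x hx y hy hyB z hz h
    obtain ⟨b, hb, c, hc, hbc, h1, h2, h3⟩ := hbase x hx y hy hyB z hz h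
    have hl : ∀ w ∈ A, R b c w → T b c w := fun w hw =>
      hBA b (Finset.mem_union_left _ hb) c (Finset.mem_union_left _ hc) w
        (Finset.mem_union_right _ hw)
    have hr : ∀ w ∈ Y, R b c w → T b c w := hY b (hB hb) c (hB hc)
    have h3' : z = b ∨ z = c ∨ T b c z :=
      h3.imp_right fun h3 => h3.imp_right fun h3 =>
        (Finset.mem_union.1 hz).elim (fun hz => hr z hz h3) (fun hz => hl z hz h3)
    exact hT.of_collinear hbc (Or.inr (Or.inr (hl x hx h1))) (Or.inr (Or.inr (hr y hy h2))) h3'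
      (hR.ne12 h) (hR.ne23 h) (hR.ne13 h)
  by_cases hall : x ∈ Y ∧ y ∈ Y ∧ z ∈ Y
  · exact hY x hall.1 y hall.2.1 z hall.2.2 h
  by_cases hall' : x ∈ B ∪ A ∧ y ∈ B ∪ A ∧ z ∈ B ∪ A
  · exact hBA x hall'.1 y hall'.2.1 z hall'.2.2 h
  have r1 := @hR.swap12
  have r2 := @hR.swap23
  have t1 := @hT.swap12
  have t2 := @hT.swap23
  have p1 := mixed x
  have p2 := mixed y
  have p3 := mixed z
  simp only [Finset.mem_union] at *
  grind

/-- The pullback of a linear space along a map injective on `N`, restricted to `N`. -/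
theorem IsLinearSpace.pullback (h : IsLinearSpace R) {N : Finset M} {g : M → M}
    (hg : Set.InjOn g ↑N) :
    IsLinearSpace fun x y z => x ∈ N ∧ y ∈ N ∧ z ∈ N ∧ R (g x) (g y) (g z) where
  ne12 := fun H e => h.ne12 H.2.2.2 (congrArg g e)
  ne23 := fun H e => h.ne23 H.2.2.2 (congrArg g e)
  ne13 := fun H e => h.ne13 H.2.2.2 (congrArg g e)
  swap12 := fun H => ⟨H.2.1, H.1, H.2.2.1, h.swap12 H.2.2.2⟩
  swap23 := fun H => ⟨H.1, H.2.2.1, H.2.1, h.swap23 H.2.2.2⟩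
  line := fun H H' hne => ⟨H.1, H'.2.2.1, H.2.2.1,
    h.line H.2.2.2 H'.2.2.2 fun e => hne (hg H.2.2.1 H'.2.2.1 e)⟩

end LinearSpace

/-- Lemma on extending isomorphisms of good pairs: if `N = Y ∪ A` (structure `S`) and
`N' = Y ∪ A'` (structure `S'`) induce the same structure on `Y`, `A` and `A'` are
`0`-primitive over `Y` and both based on `B ⊆ Y` via good pairs, and
`f : B ∪ A → B ∪ A'` is an isomorphism of induced linear spaces fixing `B` pointwise,
then the map equal to the identity on `Y` and to `f` on `A` is an isomorphism of linear
spaces from `N` onto `N'`. -/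
theorem extend_good_pair_isomorphism {M : Type*} (S S' : M → M → M → Prop)
    (hLS : IsLinearSpace S) (hLS' : IsLinearSpace S')
    (Y A A' B : Finset M)
    (hsame : ∀ x ∈ Y, ∀ y ∈ Y, ∀ z ∈ Y, (S x y z ↔ S' x y z))
    (hzp : ZeroPrimOver S Y A) (hzp' : ZeroPrimOver S' Y A')
    (hB : B ⊆ Y) (hgood : GoodPair S B A) (hgood' : GoodPair S' B A')
    (f : M → M)
    (hfinj : Set.InjOn f ↑(B ∪ A)) (hfim : (B ∪ A).image f = B ∪ A')
    (hfB : ∀ x ∈ B, f x = x)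
    (hfpres : ∀ x ∈ B ∪ A, ∀ y ∈ B ∪ A, ∀ z ∈ B ∪ A,
      (S x y z ↔ S' (f x) (f y) (f z))) :
    Set.InjOn (fun x => if x ∈ A then f x else x) ↑(Y ∪ A) ∧
    (Y ∪ A).image (fun x => if x ∈ A then f x else x) = Y ∪ A' ∧
    (∀ x ∈ Y ∪ A, ∀ y ∈ Y ∪ A, ∀ z ∈ Y ∪ A,
      (S x y z ↔ S' (if x ∈ A then f x else x) (if y ∈ A then f y else y)
        (if z ∈ A then f z else z))) := by
  set g : M → M := fun x => if x ∈ A then f x else x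
  have hYA : Disjoint Y A := hzp.1
  have hBA : Disjoint B A := hgood.1.1
  have hYA' : Disjoint Y A' := hzp'.1
  have hBA' : Disjoint B A' := hgood'.1.1
  have gA : ∀ x ∈ A, g x = f x := fun x hx => if_pos hx
  have gY : ∀ x ∈ Y, g x = x := fun x hx => if_neg (Finset.disjoint_left.1 hYA hx)
  have gBA : ∀ x ∈ B ∪ A, g x = f x := by
    intro x hx
    rcases Finset.mem_union.1 hx with hx | hx
    · rw [gY x (hB hx), hfB x hx]
    · exact gA x hx
  have gA' : ∀ x ∈ A, g x ∈ A' := by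
    intro x hx
    have hmem : f x ∈ B ∪ A' := hfim ▸ Finset.mem_image_of_mem f (Finset.mem_union_right _ hx)
    rw [gA x hx]
    refine (Finset.mem_union.1 hmem).resolve_left fun hb => ?_
    have e : f x = x := hfinj (Finset.mem_coe.2 (Finset.mem_union_left _ hb))
      (Finset.mem_coe.2 (Finset.mem_union_right _ hx)) (hfB _ hb)
    exact Finset.disjoint_left.1 hBA (e ▸ hb) hx
  have gsurj : ∀ w ∈ A', ∃ x ∈ A, g x = w := by
    intro w hw
    have hmem : w ∈ (B ∪ A).image f := hfim.symm ▸ Finset.mem_union_right _ hw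
    obtain ⟨x, hx, rfl⟩ := Finset.mem_image.1 hmem
    rcases Finset.mem_union.1 hx with hx | hx
    · rw [hfB x hx] at hw
      exact absurd hw (Finset.disjoint_left.1 hBA' hx)
    · exact ⟨x, hx, gA x hx⟩
  have gN : ∀ x ∈ Y ∪ A, g x ∈ Y ∪ A' := by
    intro x hx
    rcases Finset.mem_union.1 hx with hx | hx
    · rw [gY x hx]
      exact Finset.mem_union_left _ hx
    · exact Finset.mem_union_right _ (gA' x hx)
  have ginj : Set.InjOn g ↑(Y ∪ A) := by
    intro x hx y hy hxy
    rcases Finset.mem_union.1 (Finset.mem_coe.1 hx) with hx | hx <;>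
      rcases Finset.mem_union.1 (Finset.mem_coe.1 hy) with hy | hy
    · rwa [gY x hx, gY y hy] at hxy
    · rw [gY x hx] at hxy
      exact absurd (hxy ▸ gA' y hy) (Finset.disjoint_left.1 hYA' hx)
    · rw [gY y hy] at hxy
      exact absurd (hxy ▸ gA' x hx) (Finset.disjoint_left.1 hYA' hy)
    · rw [gA x hx, gA y hy] at hxy
      exact hfinj (Finset.mem_coe.2 (Finset.mem_union_right _ hx))
        (Finset.mem_coe.2 (Finset.mem_union_right _ hy)) hxy
  have hδ : delta S (Y ∪ A) - delta S Y = delta S (B ∪ A) - delta S B := by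
    rw [hzp.2.2.2, hgood.1.2.2.2, sub_self, sub_self]
  have hδ' : delta S' (Y ∪ A') - delta S' Y = delta S' (B ∪ A') - delta S' B := by
    rw [hzp'.2.2.2, hgood'.1.2.2.2, sub_self, sub_self]
  have hYN : Y ⊆ Y ∪ A := Finset.subset_union_left
  have hAN : A ⊆ Y ∪ A := Finset.subset_union_right
  have hBAN : B ∪ A ⊆ Y ∪ A := Finset.union_subset_union_left hB
  have hT := hLS'.pullback ginj
  refine ⟨ginj, ?_, ?_⟩
  · ext w
    rw [Finset.mem_image]
    constructor
    · rintro ⟨x, hx, rfl⟩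
      exact gN x hx
    · intro hw
      rcases Finset.mem_union.1 hw with hw | hw
      · exact ⟨w, hYN hw, gY w hw⟩
      · obtain ⟨x, hx, rfl⟩ := gsurj w hw
        exact ⟨x, hAN hx, rfl⟩
  intro x hx y hy z hz
  change S x y z ↔ S' (g x) (g y) (g z)
  constructor
  · intro h
    refine (hLS.transfer_of_exists_base_points hT hB ?_ ?_ ?_ hx hy hz h).2.2.2
    · intro x hx y hy z hz h
      refine ⟨hYN hx, hYN hy, hYN hz, ?_⟩
      rw [gY x hx, gY y hy, gY z hz]
      exact (hsame x hx y hy z hz).1 h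
    · intro x hx y hy z hz h
      refine ⟨hBAN hx, hBAN hy, hBAN hz, ?_⟩
      rw [gBA x hx, gBA y hy, gBA z hz]
      exact (hfpres x hx y hy z hz).1 h
    · intro x hx y hy hyB z hz h
      exact hLS.exists_base_points hYA hB hδ hx hy hyB hz h
  · intro h
    refine hT.transfer_of_exists_base_points hLS hB ?_ ?_ ?_ hx hy hz ⟨hx, hy, hz, h⟩
    · rintro x hx y hy z hz ⟨-, -, -, h⟩
      rw [gY x hx, gY y hy, gY z hz] at h
      exact (hsame x hx y hy z hz).2 h
    · rintro x hx y hy z hz ⟨-, -, -, h⟩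
      rw [gBA x hx, gBA y hy, gBA z hz] at h
      exact (hfpres x hx y hy z hz).2 h
    · rintro x hx y hy hyB z hz ⟨-, -, -, h⟩
      rw [gY y hy] at h
      obtain ⟨b, hb, c, hc, hbc, h1, h2, h3⟩ :=
        hLS'.exists_base_points hYA' hB hδ' (gA' x hx) hy hyB (gN z hz) h
      have hbY := hB hb
      have hcY := hB hc
      refine ⟨b, hb, c, hc, hbc, ⟨hYN hbY, hYN hcY, hAN hx, ?_⟩,
        ⟨hYN hbY, hYN hcY, hYN hy, ?_⟩, ?_⟩
      · rwa [gY b hbY, gY c hcY]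
      · rwa [gY b hbY, gY c hcY, gY y hy]
      · refine h3.imp (fun e => ginj hz (hYN hbY) (e.trans (gY b hbY).symm)) fun h3 =>
          h3.imp (fun e => ginj hz (hYN hcY) (e.trans (gY c hcY).symm)) fun h3 =>
            ⟨hYN hbY, hYN hcY, hz, ?_⟩
        rwa [gY b hbY, gY c hcY]
end

section
/- For every μ ∈ U, the class (K_μ, ≤) has the amalgamation property: whenever D, E, F ∈ K_μ with D ≤ E and D ≤ F, there exist G ∈ K_μ and embeddings of linear spaces f : E → G and g : F → G that agree on D, such that f(E) ≤ G and g(F) ≤ G. -/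
open scoped Classical

universe u

/-- The restriction of the ternary relation `S` to the set `X`. -/
def RestrictLS {M : Type*} (S : M → M → M → Prop) (X : Finset M) : M → M → M → Prop :=
  fun a b c => a ∈ X ∧ b ∈ X ∧ c ∈ X ∧ S a b c

/-- An isomorphism of pairs `(B, A)` and `(B', A')`: an isomorphism of the induced
linear spaces from `B ∪ A` onto `B' ∪ A'` carrying `B` onto `B'`. -/
def GoodPairIso {M N : Type*} (R : M → M → M → Prop) (S : N → N → N → Prop)
    (B A : Finset M) (B' A' : Finset N) : Prop :=
  ∃ f : M → N, Set.InjOn f ↑(B ∪ A) ∧ (B ∪ A).image f = B' ∪ A' ∧ B.image f = B' ∧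
    ∀ x ∈ B ∪ A, ∀ y ∈ B ∪ A, ∀ z ∈ B ∪ A, (R x y z ↔ S (f x) (f y) (f z))

/-- `C'` is a copy of the good pair `(BP, CP)` over the embedded base `BP.image e`:
`C'` is disjoint from the base and there is an isomorphism `φ` of `BP ∪ CP` onto
`(BP.image e) ∪ C'` extending `e` on `BP`. -/
def IsCopyOver {P N : Type u} (T : P → P → P → Prop) (S : N → N → N → Prop)
    (BP CP : Finset P) (e : P → N) (C' : Finset N) : Prop :=
  Disjoint C' (BP.image e) ∧
  ∃ φ : P → N, (∀ x ∈ BP, φ x = e x) ∧ Set.InjOn φ ↑(BP ∪ CP) ∧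
    CP.image φ = C' ∧
    ∀ x ∈ BP ∪ CP, ∀ y ∈ BP ∪ CP, ∀ z ∈ BP ∪ CP, (T x y z ↔ S (φ x) (φ y) (φ z))

/-- `μ ∈ U`: `μ` assigns to every isomorphism type of a good pair `(B, C)` (in `K₀`) an
integer which is `≥ δ(B)` when `|C| ≥ 2`, and `≥ 1` for the type `α` of the good pair
`({b₁,b₂}, {a})` with `R b₁ b₂ a`. -/
def MuInU (μ : ∀ P : Type u, (P → P → P → Prop) → Finset P → Finset P → ℤ) : Prop :=
  (∀ (P Q : Type u) (T : P → P → P → Prop) (T' : Q → Q → Q → Prop)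
      (B C : Finset P) (B' C' : Finset Q),
      GoodPair T B C → GoodPair T' B' C' → GoodPairIso T T' B C B' C' →
      μ P T B C = μ Q T' B' C') ∧
  (∀ (P : Type u) (T : P → P → P → Prop) (B C : Finset P),
      IsLinearSpace (RestrictLS T (B ∪ C)) → InK0 T (B ∪ C) → GoodPair T B C →
      2 ≤ C.card → delta T B ≤ μ P T B C) ∧
  (∀ (P : Type u) (T : P → P → P → Prop) (b₁ b₂ x : P),
      IsLinearSpace (RestrictLS T ({b₁, b₂, x} : Finset P)) →
      InK0 T ({b₁, b₂, x} : Finset P) →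
      GoodPair T ({b₁, b₂} : Finset P) ({x} : Finset P) → T b₁ b₂ x →
      1 ≤ μ P T ({b₁, b₂} : Finset P) ({x} : Finset P))

/-- `Mdom ∈ K_μ` (with structure `S`): `Mdom ∈ K₀` and for every good pair `(BP, CP)` in
`K₀` and every embedding `e` of its base into `Mdom`, any family of pairwise disjoint
copies of `(BP, CP)` over the embedded base has at most `μ(BP, CP)` members. -/
def InKmu {N : Type u} (μ : ∀ P : Type u, (P → P → P → Prop) → Finset P → Finset P → ℤ)
    (S : N → N → N → Prop) (Mdom : Finset N) : Prop :=
  InK0 S Mdom ∧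
  ∀ (P : Type u) (T : P → P → P → Prop) (BP CP : Finset P),
    IsLinearSpace (RestrictLS T (BP ∪ CP)) → InK0 T (BP ∪ CP) → GoodPair T BP CP →
    ∀ e : P → N, Set.InjOn e ↑BP → BP.image e ⊆ Mdom →
      (∀ x ∈ BP, ∀ y ∈ BP, ∀ z ∈ BP, (T x y z ↔ S (e x) (e y) (e z))) →
      ∀ 𝒞 : Finset (Finset N),
        (∀ C' ∈ 𝒞, C' ⊆ Mdom ∧ IsCopyOver T S BP CP e C') →
        (∀ C₁ ∈ 𝒞, ∀ C₂ ∈ 𝒞, C₁ ≠ C₂ → Disjoint C₁ C₂) →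
        (𝒞.card : ℤ) ≤ μ P T BP CP

section Transport

variable {M N : Type*} {R : M → M → M → Prop} {S : N → N → N → Prop}

/-- `φ` preserves and reflects the ternary relation on `A`. -/
def RelIsoOn (R : M → M → M → Prop) (S : N → N → N → Prop) (φ : M → N) (A : Finset M) : Prop :=
  ∀ x ∈ A, ∀ y ∈ A, ∀ z ∈ A, (R x y z ↔ S (φ x) (φ y) (φ z))

theorem RelIsoOn.mono {φ : M → N} {A A' : Finset M} (h : RelIsoOn R S φ A) (hA : A' ⊆ A) :
    RelIsoOn R S φ A' :=
  fun x hx y hy z hz => h x (hA hx) y (hA hy) z (hA hz)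

theorem finClique_image_iff {φ : M → N} {A : Finset M} (hinj : Set.InjOn φ A)
    (h : RelIsoOn R S φ A) {X : Finset M} (hX : X ⊆ A) :
    FinClique S (X.image φ) ↔ FinClique R X := by
  constructor
  · intro hc a ha b hb c hc' hab hbc hac
    refine (h a (hX ha) b (hX hb) c (hX hc')).2 (hc _ (Finset.mem_image_of_mem _ ha) _
      (Finset.mem_image_of_mem _ hb) _ (Finset.mem_image_of_mem _ hc') ?_ ?_ ?_)
    · exact fun e => hab (hinj (hX ha) (hX hb) e)
    · exact fun e => hbc (hinj (hX hb) (hX hc') e)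
    · exact fun e => hac (hinj (hX ha) (hX hc') e)
  · intro hc a' ha' b' hb' c' hc'' hab hbc hac
    obtain ⟨a, ha, rfl⟩ := Finset.mem_image.1 ha'
    obtain ⟨b, hb, rfl⟩ := Finset.mem_image.1 hb'
    obtain ⟨c, hc', rfl⟩ := Finset.mem_image.1 hc''
    exact (h a (hX ha) b (hX hb) c (hX hc')).1 (hc a ha b hb c hc' (fun e => hab (e ▸ rfl))
      (fun e => hbc (e ▸ rfl)) (fun e => hac (e ▸ rfl)))

theorem image_subset_image_iff_of_injOn {φ : M → N} {A X Y : Finset M} (hinj : Set.InjOn φ A)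
    (hX : X ⊆ A) (hY : Y ⊆ A) : X.image φ ⊆ Y.image φ ↔ X ⊆ Y := by
  refine ⟨fun h x hx => ?_, Finset.image_subset_image⟩
  obtain ⟨y, hy, e⟩ := Finset.mem_image.1 (h (Finset.mem_image_of_mem _ hx))
  exact hinj (hY hy) (hX hx) e ▸ hy

theorem image_injOn_of_injOn {φ : M → N} {A X Y : Finset M} (hinj : Set.InjOn φ A)
    (hX : X ⊆ A) (hY : Y ⊆ A) (h : X.image φ = Y.image φ) : X = Y :=
  Finset.Subset.antisymm ((image_subset_image_iff_of_injOn hinj hX hY).1 h.le)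
    ((image_subset_image_iff_of_injOn hinj hY hX).1 h.ge)

theorem card_image_of_subset_injOn {φ : M → N} {A X : Finset M} (hinj : Set.InjOn φ A)
    (hX : X ⊆ A) : (X.image φ).card = X.card :=
  Finset.card_image_of_injOn (hinj.mono (by exact_mod_cast hX))

theorem isLineOf_image_iff {φ : M → N} {A : Finset M} (hinj : Set.InjOn φ A)
    (h : RelIsoOn R S φ A) {X : Finset M} (hX : X ⊆ A) :
    IsLineOf S (A.image φ) (X.image φ) ↔ IsLineOf R A X := by
  unfold IsLineOf
  rw [image_subset_image_iff_of_injOn hinj hX subset_rfl, card_image_of_subset_injOn hinj hX,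
    finClique_image_iff hinj h hX]
  refine and_congr_right fun _ => and_congr_right fun _ => and_congr_right fun _ => ?_
  constructor
  · intro H Y hY hc hXY
    exact image_injOn_of_injOn hinj hY hX (H (Y.image φ) (Finset.image_subset_image hY)
      ((finClique_image_iff hinj h hY).2 hc) (Finset.image_subset_image hXY))
  · intro H Y hY hc hXY
    obtain ⟨Y, hY', rfl⟩ := Finset.subset_image_iff.1 hY
    have hY' : Y ⊆ A := by exact_mod_cast hY'
    rw [H Y hY' ((finClique_image_iff hinj h hY').1 hc)
      ((image_subset_image_iff_of_injOn hinj hX hY').1 hXY)]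

theorem delta_image {φ : M → N} {A : Finset M} (hinj : Set.InjOn φ A)
    (h : RelIsoOn R S φ A) : delta S (A.image φ) = delta R A := by
  have hl : linesOf S (A.image φ) = (linesOf R A).image (Finset.image φ) := by
    ext ℓ
    simp only [linesOf, Finset.mem_filter, Finset.mem_powerset, Finset.mem_image]
    constructor
    · rintro ⟨h1, h2⟩
      obtain ⟨X, hX, rfl⟩ := Finset.subset_image_iff.1 h1
      have hX : X ⊆ A := by exact_mod_cast hX
      exact ⟨X, ⟨hX, (isLineOf_image_iff hinj h hX).1 h2⟩, rfl⟩
    · rintro ⟨X, ⟨hX, h2⟩, rfl⟩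
      exact ⟨Finset.image_subset_image hX, (isLineOf_image_iff hinj h hX).2 h2⟩
  have hsub : ∀ X ∈ linesOf R A, X ⊆ A := fun X hX =>
    Finset.mem_powerset.1 (Finset.mem_filter.1 hX).1
  unfold delta
  rw [hl, Finset.card_image_of_injOn hinj, Finset.sum_image]
  · congr 1
    exact Finset.sum_congr rfl fun X hX => by rw [card_image_of_subset_injOn hinj (hsub X hX)]
  · intro X hX Y hY e
    exact image_injOn_of_injOn hinj (hsub X hX) (hsub Y hY) e

theorem delta_image_subset {φ : M → N} {A X : Finset M} (hinj : Set.InjOn φ A)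
    (h : RelIsoOn R S φ A) (hX : X ⊆ A) : delta S (X.image φ) = delta R X :=
  delta_image (hinj.mono (by exact_mod_cast hX)) (h.mono hX)

theorem delta_congr {R R' : M → M → M → Prop} {A : Finset M} (h : RelIsoOn R R' id A) :
    delta R A = delta R' A := by
  simpa using (delta_image (Set.injOn_id _) h).symm

theorem Strong.image {φ : M → N} {A B : Finset M} (hinj : Set.InjOn φ B)
    (h : RelIsoOn R S φ B) (hs : Strong R A B) : Strong S (A.image φ) (B.image φ) := by
  refine ⟨Finset.image_subset_image hs.1, fun X hAX hXB => ?_⟩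
  obtain ⟨X, hX, rfl⟩ := Finset.subset_image_iff.1 hXB
  have hX : X ⊆ B := by exact_mod_cast hX
  rw [delta_image_subset hinj h hX, delta_image_subset hinj h hs.1]
  exact hs.2 X ((image_subset_image_iff_of_injOn hinj hs.1 hX).1 hAX) hX

theorem InK0.of_image {φ : M → N} {A : Finset M} {B : Finset N} (hinj : Set.InjOn φ A)
    (h : RelIsoOn R S φ A) (hAB : A.image φ ⊆ B) (hB : InK0 S B) : InK0 R A := fun X hX => by
  rw [← delta_image_subset hinj h hX]
  exact hB _ ((Finset.image_subset_image hX).trans hAB)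

theorem zeroPrimOver_iff {B C : Finset M} :
    ZeroPrimOver R B C ↔ Disjoint B C ∧ C.Nonempty ∧ delta R (B ∪ C) = delta R B ∧
      ∀ X ⊂ C, X.Nonempty → delta R B < delta R (B ∪ X) := by
  constructor
  · rintro ⟨hd, hne, ⟨hs, hp⟩, he⟩
    refine ⟨hd, hne, he, fun X hX hXne => ?_⟩
    have hle : delta R B ≤ delta R (B ∪ X) :=
      hs.2 _ Finset.subset_union_left (Finset.union_subset_union_right hX.1)
    refine lt_of_le_of_ne hle fun heq => hp ⟨B ∪ X, ?_, ?_, ?_, ?_⟩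
    · refine Finset.ssubset_iff_subset_ne.2 ⟨Finset.subset_union_left, fun e => ?_⟩
      obtain ⟨x, hx⟩ := hXne
      exact Finset.disjoint_left.1 hd (e ▸ Finset.mem_union_right _ hx) (hX.1 hx)
    · refine Finset.ssubset_iff_subset_ne.2
        ⟨Finset.union_subset_union_right hX.1, fun e => hX.2 fun c hc => ?_⟩
      have : c ∈ B ∪ X := e ▸ Finset.mem_union_right _ hc
      exact (Finset.mem_union.1 this).resolve_left fun hb => Finset.disjoint_left.1 hd hb hc
    · exact ⟨Finset.subset_union_left, fun Y h1 h2 =>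
        hs.2 Y h1 (h2.trans (Finset.union_subset_union_right hX.1))⟩
    · exact ⟨Finset.union_subset_union_right hX.1, fun Y h1 h2 =>
        heq ▸ hs.2 Y (Finset.subset_union_left.trans h1) h2⟩
  · rintro ⟨hd, hne, he, hX⟩
    have key : ∀ Y, B ⊆ Y → Y ⊆ B ∪ C → Y = B ∪ (Y \ B) ∧ Y \ B ⊆ C := fun Y h1 h2 =>
      ⟨by simp [Finset.union_sdiff_of_subset h1], fun y hy => by
        have := h2 (Finset.mem_sdiff.1 hy).1
        exact (Finset.mem_union.1 this).resolve_left (Finset.mem_sdiff.1 hy).2⟩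
    refine ⟨hd, hne, ⟨⟨Finset.subset_union_left, fun Y h1 h2 => ?_⟩, ?_⟩, he⟩
    · obtain ⟨e, hs⟩ := key Y h1 h2
      rcases (Y \ B).eq_empty_or_nonempty with h0 | h0
      · rw [e, h0, Finset.union_empty]
      · rcases hs.eq_or_ssubset with h3 | h3
        · rw [e, h3, he]
        · rw [e]
          exact (hX _ h3 h0).le
    · rintro ⟨Y, h1, h2, -, h4⟩
      obtain ⟨e, hs⟩ := key Y h1.1 h2.1
      have h0 : (Y \ B).Nonempty := Finset.sdiff_nonempty.2 h1.2
      have h3 : Y \ B ⊂ C := by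
        refine Finset.ssubset_iff_subset_ne.2 ⟨hs, fun e' => h2.ne ?_⟩
        rw [e, e']
      have h5 := hX _ h3 h0
      rw [← e] at h5
      have h6 := h4.2 _ h2.1 subset_rfl
      omega

theorem ZeroPrimOver.of_image {φ : M → N} {B C : Finset M} (hinj : Set.InjOn φ ↑(B ∪ C))
    (h : RelIsoOn R S φ (B ∪ C)) (hz : ZeroPrimOver S (B.image φ) (C.image φ)) :
    ZeroPrimOver R B C := by
  rw [zeroPrimOver_iff] at hz ⊢
  obtain ⟨hd, hne, he, hX⟩ := hz
  have hB : B ⊆ B ∪ C := Finset.subset_union_left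
  refine ⟨Finset.disjoint_left.2 fun x hb hc => Finset.disjoint_left.1 hd
    (Finset.mem_image_of_mem _ hb) (Finset.mem_image_of_mem _ hc), Finset.image_nonempty.1 hne, ?_,
    fun X hXC hXne => ?_⟩
  · rw [← Finset.image_union, delta_image hinj h, delta_image_subset hinj h hB] at he
    exact he
  · have hXs : X ⊆ B ∪ C := hXC.1.trans Finset.subset_union_right
    have := hX (X.image φ) ?_ (hXne.image φ)
    · rw [← Finset.image_union, delta_image_subset hinj h hB,
        delta_image_subset hinj h (Finset.union_subset hB hXs)] at this
      exact this
    · exact ⟨Finset.image_subset_image hXC.1, fun hs => hXC.2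
        ((image_subset_image_iff_of_injOn hinj Finset.subset_union_right hXs).1 hs)⟩

theorem ZeroPrimOver.image {φ : M → N} {B C : Finset M} (hinj : Set.InjOn φ ↑(B ∪ C))
    (h : RelIsoOn R S φ (B ∪ C)) (hz : ZeroPrimOver R B C) :
    ZeroPrimOver S (B.image φ) (C.image φ) := by
  rw [zeroPrimOver_iff] at hz ⊢
  obtain ⟨hd, hne, he, hX⟩ := hz
  have hB : B ⊆ B ∪ C := Finset.subset_union_left
  have hC : C ⊆ B ∪ C := Finset.subset_union_right
  refine ⟨Finset.disjoint_left.2 fun x hxb hxc => ?_, hne.image φ, ?_, fun X hXC hXne => ?_⟩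
  · obtain ⟨b, hb, rfl⟩ := Finset.mem_image.1 hxb
    obtain ⟨c, hc, e⟩ := Finset.mem_image.1 hxc
    exact Finset.disjoint_left.1 hd hb (hinj (hC hc) (hB hb) e ▸ hc)
  · rw [← Finset.image_union, delta_image hinj h, delta_image_subset hinj h hB, he]
  · obtain ⟨X, hXC', rfl⟩ := Finset.subset_image_iff.1 hXC.1
    have hXC' : X ⊆ C := by exact_mod_cast hXC'
    rw [← Finset.image_union, delta_image_subset hinj h hB,
      delta_image_subset hinj h (Finset.union_subset hB (hXC'.trans hC))]
    exact hX X ⟨hXC', fun hs => hXC.2 (Finset.image_subset_image hs)⟩ (Finset.image_nonempty.1 hXne)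

theorem GoodPair.image {φ : M → N} {B C : Finset M} (hinj : Set.InjOn φ ↑(B ∪ C))
    (h : RelIsoOn R S φ (B ∪ C)) (hg : GoodPair R B C) :
    GoodPair S (B.image φ) (C.image φ) := by
  refine ⟨hg.1.image hinj h, fun B' hB' hz => ?_⟩
  obtain ⟨B', hs, rfl⟩ := Finset.subset_image_iff.1 hB'.1
  have hs : B' ⊆ B := by exact_mod_cast hs
  have hu : B' ∪ C ⊆ B ∪ C := Finset.union_subset_union_left hs
  exact hg.2 B' ⟨hs, fun h' => hB'.2 (Finset.image_subset_image h')⟩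
    (hz.of_image (hinj.mono (by exact_mod_cast hu)) (h.mono hu))

end Transport

theorem InKmu.of_image {M N : Type u} {R : M → M → M → Prop} {S : N → N → N → Prop}
    {μ : ∀ P : Type u, (P → P → P → Prop) → Finset P → Finset P → ℤ}
    {φ : M → N} {A : Finset M} {B : Finset N} (hinj : Set.InjOn φ A)
    (h : RelIsoOn R S φ A) (hAB : A.image φ ⊆ B) (hB : InKmu μ S B) : InKmu μ R A := by
  refine ⟨hB.1.of_image hinj h hAB, fun P T BP CP hl h0 hg e he heA hiso 𝒞 hcopy hdisj => ?_⟩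
  have heA' : ∀ x ∈ BP, e x ∈ A := fun x hx => heA (Finset.mem_image_of_mem _ hx)
  have hmem : ∀ C ∈ 𝒞, C ⊆ A := fun C hC => (hcopy C hC).1
  have hcard : (𝒞.image (Finset.image φ)).card = 𝒞.card :=
    Finset.card_image_of_injOn fun X hX Y hY hXY =>
      image_injOn_of_injOn hinj (hmem X hX) (hmem Y hY) hXY
  rw [← hcard]
  refine hB.2 P T BP CP hl h0 hg (φ ∘ e) (fun x hx y hy hxy => he hx hy
      (hinj (heA' x hx) (heA' y hy) hxy)) ?_ (fun x hx y hy z hz => ?_) _ ?_ ?_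
  · rw [← Finset.image_image]
    exact (Finset.image_subset_image heA).trans hAB
  · exact (hiso x hx y hy z hz).trans (h _ (heA' x hx) _ (heA' y hy) _ (heA' z hz))
  · intro C' hC'
    obtain ⟨C, hC, rfl⟩ := Finset.mem_image.1 hC'
    obtain ⟨hCA, hd, ψ, hψe, hψi, hψC, hψ⟩ := hcopy C hC
    have hψA : ∀ x ∈ BP ∪ CP, ψ x ∈ A := fun x hx => by
      rcases Finset.mem_union.1 hx with hx | hx
      · rw [hψe x hx]
        exact heA' x hx
      · exact hCA (hψC ▸ Finset.mem_image_of_mem _ hx)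
    refine ⟨(Finset.image_subset_image hCA).trans hAB, ?_, φ ∘ ψ, fun x hx => ?_, ?_, ?_, ?_⟩
    · rw [← Finset.image_image]
      refine Finset.disjoint_left.2 fun x hx hx' => ?_
      obtain ⟨c, hc, rfl⟩ := Finset.mem_image.1 hx
      obtain ⟨b, hb, e'⟩ := Finset.mem_image.1 hx'
      exact Finset.disjoint_left.1 hd hc (hinj (heA hb) (hCA hc) e' ▸ hb)
    · simp [hψe x hx]
    · exact fun x hx y hy hxy => hψi hx hy (hinj (hψA x hx) (hψA y hy) hxy)
    · rw [← Finset.image_image, hψC]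
    · exact fun x hx y hy z hz => (hψ x hx y hy z hz).trans
        (h _ (hψA x hx) _ (hψA y hy) _ (hψA z hz))
  · intro C₁' h₁' C₂' h₂' hne
    obtain ⟨C₁, h₁, rfl⟩ := Finset.mem_image.1 h₁'
    obtain ⟨C₂, h₂, rfl⟩ := Finset.mem_image.1 h₂'
    have hd := hdisj C₁ h₁ C₂ h₂ (fun e => hne (e ▸ rfl))
    refine Finset.disjoint_left.2 fun x hx hx' => ?_
    obtain ⟨a, ha, rfl⟩ := Finset.mem_image.1 hx
    obtain ⟨b, hb, e'⟩ := Finset.mem_image.1 hx'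
    exact Finset.disjoint_left.1 hd ha (hinj (hmem _ h₂ hb) (hmem _ h₁ ha) e' ▸ hb)

section Lines

variable {M : Type*} {R : M → M → M → Prop}

namespace IsLinearSpace

theorem collinear_of_common_pair (hR : IsLinearSpace R) {x y a b c : M}
    (ha : a = x ∨ a = y ∨ R x y a) (hb : b = x ∨ b = y ∨ R x y b)
    (hc : c = x ∨ c = y ∨ R x y c) (hxy : x ≠ y) (hab : a ≠ b) (hbc : b ≠ c) (hac : a ≠ c) :
    R a b c := by
  have l := @hR.line
  have s1 := @hR.swap12
  have s2 := @hR.swap23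
  have key : ∀ {p q r}, R x y p → R x y q → R x y r → p ≠ q → q ≠ r → p ≠ r → R p q r := by
    intro p q r hp hq hr hpq hqr hpr
    have h1 : R x p q := s2 (l hp hq hpq)
    have h2 : R x p r := s2 (l hp hr hpr)
    exact s2 (l (s1 h1) (s1 h2) hqr)
  have k2 : ∀ {p q}, R x y p → R x y q → p ≠ q → R x p q := fun hp hq h => s2 (l hp hq h)
  have k3 : ∀ {p q}, R x y p → R x y q → p ≠ q → R y p q := fun hp hq h =>
    s2 (l (s1 hp) (s1 hq) h)
  rcases ha with rfl | rfl | ha <;> rcases hb with rfl | rfl | hb <;>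
    rcases hc with rfl | rfl | hc <;> first
      | exact absurd rfl hab
      | exact absurd rfl hbc
      | exact absurd rfl hac
      | exact key ha hb hc hab hbc hac
      | exact hc
      | exact s1 hc
      | exact s2 hb
      | exact s2 (s1 hb)
      | exact s1 (s2 ha)
      | exact s1 (s2 (s1 ha))
      | exact k2 hb hc hbc
      | exact k3 hb hc hbc
      | exact s1 (k2 ha hc hac)
      | exact s1 (k3 ha hc hac)
      | exact s2 (s1 (k2 ha hb hab))
      | exact s2 (s1 (k3 ha hb hab))

theorem linesOf_subset {A ℓ : Finset M} (h : ℓ ∈ linesOf R A) : ℓ ⊆ A :=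
  Finset.mem_powerset.1 (Finset.mem_filter.1 h).1

theorem isLineOf_of_mem {A ℓ : Finset M} (h : ℓ ∈ linesOf R A) : IsLineOf R A ℓ :=
  (Finset.mem_filter.1 h).2

theorem mem_linesOf {A ℓ : Finset M} : ℓ ∈ linesOf R A ↔ IsLineOf R A ℓ :=
  ⟨isLineOf_of_mem, fun h => Finset.mem_filter.2 ⟨Finset.mem_powerset.2 h.1, h⟩⟩

theorem rel_of_mem_line {A ℓ : Finset M} (h : ℓ ∈ linesOf R A) {a b c : M} (ha : a ∈ ℓ)
    (hb : b ∈ ℓ) (hc : c ∈ ℓ) (hab : a ≠ b) (hbc : b ≠ c) (hac : a ≠ c) : R a b c :=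
  (isLineOf_of_mem h).2.2.1 a ha b hb c hc hab hbc hac

theorem finClique_filter (hR : IsLinearSpace R) (A : Finset M) {x y : M} (hxy : x ≠ y) :
    FinClique R (A.filter fun t => t = x ∨ t = y ∨ R x y t) := by
  intro a ha b hb c hc hab hbc hac
  exact hR.collinear_of_common_pair (Finset.mem_filter.1 ha).2 (Finset.mem_filter.1 hb).2
    (Finset.mem_filter.1 hc).2 hxy hab hbc hac

theorem subset_filter_of_finClique {A X : Finset M} (hX : FinClique R X) (hXA : X ⊆ A) {x y : M}
    (hx : x ∈ X) (hy : y ∈ X) (hxy : x ≠ y) :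
    X ⊆ A.filter fun t => t = x ∨ t = y ∨ R x y t := by
  intro t ht
  refine Finset.mem_filter.2 ⟨hXA ht, ?_⟩
  by_cases h1 : t = x
  · exact Or.inl h1
  by_cases h2 : t = y
  · exact Or.inr (Or.inl h2)
  exact Or.inr (Or.inr (hX x hx y hy t ht hxy (Ne.symm h2) (Ne.symm h1)))

theorem line_eq_filter (hR : IsLinearSpace R) {A ℓ : Finset M} (h : ℓ ∈ linesOf R A) {x y : M}
    (hx : x ∈ ℓ) (hy : y ∈ ℓ) (hxy : x ≠ y) :
    ℓ = A.filter fun t => t = x ∨ t = y ∨ R x y t := by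
  have hl := isLineOf_of_mem h
  exact (hl.2.2.2 _ (Finset.filter_subset _ _) (hR.finClique_filter A hxy)
    (subset_filter_of_finClique hl.2.2.1 hl.1 hx hy hxy)).symm

theorem line_unique (hR : IsLinearSpace R) {A ℓ ℓ' : Finset M} (h : ℓ ∈ linesOf R A)
    (h' : ℓ' ∈ linesOf R A) (hc : 2 ≤ (ℓ ∩ ℓ').card) : ℓ = ℓ' := by
  obtain ⟨x, hx, y, hy, hxy⟩ := Finset.one_lt_card.1 hc
  rw [Finset.mem_inter] at hx hy
  rw [hR.line_eq_filter h hx.1 hy.1 hxy, hR.line_eq_filter h' hx.2 hy.2 hxy]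

theorem exists_line (hR : IsLinearSpace R) {A : Finset M} {x y z : M} (hx : x ∈ A) (hy : y ∈ A)
    (hz : z ∈ A) (h : R x y z) : ∃ ℓ ∈ linesOf R A, x ∈ ℓ ∧ y ∈ ℓ ∧ z ∈ ℓ := by
  have hxy := hR.ne12 h
  refine ⟨A.filter fun t => t = x ∨ t = y ∨ R x y t, mem_linesOf.2 ⟨Finset.filter_subset _ _, ?_,
    hR.finClique_filter A hxy, fun X hX hc hs => ?_⟩, by simp [hx], by simp [hy], by simp [hz, h]⟩
  · refine Finset.two_lt_card.2 ⟨x, by simp [hx], y, by simp [hy], z, by simp [hz, h], hxy,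
      hR.ne13 h, hR.ne23 h⟩
  · exact Finset.Subset.antisymm
      (subset_filter_of_finClique hc hX (hs (by simp [hx])) (hs (by simp [hy])) hxy) hs

theorem isLineOf_inter (hR : IsLinearSpace R) {A X ℓ : Finset M} (hX : X ⊆ A)
    (h : ℓ ∈ linesOf R A) (hc : 3 ≤ (X ∩ ℓ).card) : X ∩ ℓ ∈ linesOf R X := by
  obtain ⟨x, hx, y, hy, hxy⟩ := Finset.one_lt_card.1 (show 1 < (X ∩ ℓ).card by omega)
  have hx' := Finset.mem_inter.1 hx
  have hy' := Finset.mem_inter.1 hy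
  refine mem_linesOf.2 ⟨Finset.inter_subset_left, hc, ?_, fun Y hY hYc hs => ?_⟩
  · exact fun a ha b hb c hc => (isLineOf_of_mem h).2.2.1 a (Finset.mem_inter.1 ha).2 b
      (Finset.mem_inter.1 hb).2 c (Finset.mem_inter.1 hc).2
  · refine Finset.Subset.antisymm (Finset.subset_inter hY ?_) hs
    rw [hR.line_eq_filter h hx'.2 hy'.2 hxy]
    exact subset_filter_of_finClique hYc (hY.trans hX) (hs hx) (hs hy) hxy

/-- The predimension of a subset computed with the lines of an ambient linear space. -/
theorem delta_eq_s19 (hR : IsLinearSpace R) {A X : Finset M} (hX : X ⊆ A) :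
    delta R X = X.card - ∑ ℓ ∈ linesOf R A, (((X ∩ ℓ).card - 2 : ℕ) : ℤ) := by
  have himg : linesOf R X =
      ((linesOf R A).filter fun ℓ => 3 ≤ (X ∩ ℓ).card).image (fun ℓ => X ∩ ℓ) := by
    ext k
    simp only [Finset.mem_image, Finset.mem_filter]
    constructor
    · intro hk
      have hk' := isLineOf_of_mem hk
      obtain ⟨x, hx, y, hy, z, hz, hxy, hxz, hyz⟩ := Finset.two_lt_card.1 hk'.2.1
      obtain ⟨ℓ, hℓ, h1, h2, h3⟩ := hR.exists_line (hX (hk'.1 hx)) (hX (hk'.1 hy))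
        (hX (hk'.1 hz)) (hk'.2.2.1 x hx y hy z hz hxy hyz hxz)
      have hkl : k ⊆ X ∩ ℓ := by
        refine Finset.subset_inter hk'.1 ?_
        rw [hR.line_eq_filter hℓ h1 h2 hxy]
        exact subset_filter_of_finClique hk'.2.2.1 (hk'.1.trans hX) hx hy hxy
      have h3 : 3 ≤ (X ∩ ℓ).card := hk'.2.1.trans (Finset.card_le_card hkl)
      exact ⟨ℓ, ⟨hℓ, h3⟩, hk'.2.2.2 _ Finset.inter_subset_left
        (isLineOf_of_mem (hR.isLineOf_inter hX hℓ h3)).2.2.1 hkl⟩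
    · rintro ⟨ℓ, ⟨hℓ, h3⟩, rfl⟩
      exact hR.isLineOf_inter hX hℓ h3
  unfold delta
  rw [himg, Finset.sum_image, Finset.sum_filter]
  · congr 1
    refine Finset.sum_congr rfl fun ℓ _ => ?_
    split_ifs <;> omega
  · intro ℓ hℓ ℓ' hℓ' e
    have hℓ := Finset.mem_filter.1 hℓ
    have hℓ' := Finset.mem_filter.1 hℓ'
    refine hR.line_unique hℓ.1 hℓ'.1 ?_
    have : X ∩ ℓ ⊆ ℓ ∩ ℓ' := Finset.subset_inter Finset.inter_subset_right
      ((show X ∩ ℓ = X ∩ ℓ' from e) ▸ Finset.inter_subset_right)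
    have := Finset.card_le_card this
    omega

end IsLinearSpace

end Lines

section Submodularity

variable {M : Type*} {R : M → M → M → Prop}

namespace IsLinearSpace

theorem delta_submodular (hR : IsLinearSpace R) (X Y : Finset M) :
    delta R (X ∪ Y) + delta R (X ∩ Y) ≤ delta R X + delta R Y := by
  rw [hR.delta_eq_s19 (A := X ∪ Y) subset_rfl, hR.delta_eq_s19 (A := X ∪ Y) (X := X ∩ Y)
    (Finset.inter_subset_left.trans Finset.subset_union_left),
    hR.delta_eq_s19 (A := X ∪ Y) (X := X) Finset.subset_union_left,
    hR.delta_eq_s19 (A := X ∪ Y) (X := Y) Finset.subset_union_right]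
  have hc := Finset.card_union_add_card_inter X Y
  have hs : ∑ ℓ ∈ linesOf R (X ∪ Y), (((X ∩ ℓ).card - 2 : ℕ) : ℤ) +
      ∑ ℓ ∈ linesOf R (X ∪ Y), (((Y ∩ ℓ).card - 2 : ℕ) : ℤ) ≤
      ∑ ℓ ∈ linesOf R (X ∪ Y), ((((X ∪ Y) ∩ ℓ).card - 2 : ℕ) : ℤ) +
      ∑ ℓ ∈ linesOf R (X ∪ Y), ((((X ∩ Y) ∩ ℓ).card - 2 : ℕ) : ℤ) := by
    rw [← Finset.sum_add_distrib, ← Finset.sum_add_distrib]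
    refine Finset.sum_le_sum fun ℓ _ => ?_
    have h1 := Finset.card_union_add_card_inter (X ∩ ℓ) (Y ∩ ℓ)
    rw [← Finset.union_inter_distrib_right, ← Finset.inter_inter_distrib_right] at h1
    have h2 : (X ∩ ℓ).card ≤ ((X ∪ Y) ∩ ℓ).card :=
      Finset.card_le_card (Finset.inter_subset_inter_right Finset.subset_union_left)
    have h3 : (Y ∩ ℓ).card ≤ ((X ∪ Y) ∩ ℓ).card :=
      Finset.card_le_card (Finset.inter_subset_inter_right Finset.subset_union_right)
    omega
  omega

theorem delta_union_le (hR : IsLinearSpace R) {X Y Z : Finset M} (hXY : X ⊆ Y)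
    (hZ : Y ∩ Z ⊆ X) : delta R (Y ∪ Z) + delta R X ≤ delta R (X ∪ Z) + delta R Y := by
  have h := hR.delta_submodular (X ∪ Z) Y
  have h1 : X ∪ Z ∪ Y = Y ∪ Z := by
    ext t; have := @hXY t; simp only [Finset.mem_union]; tauto
  have h2 : (X ∪ Z) ∩ Y = X := by
    ext t
    have := @hXY t
    have := @hZ t
    simp only [Finset.mem_union, Finset.mem_inter] at *
    tauto
  rwa [h1, h2] at h

theorem strong_inter_le (hR : IsLinearSpace R) {D F X : Finset M} (h : Strong R D F)
    (hX : X ⊆ F) : delta R (X ∩ D) ≤ delta R X := by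
  have h1 := hR.delta_submodular X D
  have h2 := h.2 (X ∪ D) Finset.subset_union_right (Finset.union_subset hX h.1)
  omega

theorem card_union_singleton_inter {X ℓ : Finset M} {a : M} (ha : a ∉ X) :
    ((X ∪ {a}) ∩ ℓ).card = (X ∩ ℓ).card + if a ∈ ℓ then 1 else 0 := by
  rw [Finset.union_inter_distrib_right, Finset.card_union_of_disjoint]
  · split_ifs with h <;> simp [h]
  · exact Finset.disjoint_left.2 fun t h1 h2 => ha (by
      have := Finset.mem_inter.1 h2
      simp only [Finset.mem_singleton] at this
      exact this.1 ▸ (Finset.mem_inter.1 h1).1)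

theorem delta_union_singleton_le (hR : IsLinearSpace R) {X : Finset M} {a : M} (ha : a ∉ X) :
    delta R (X ∪ {a}) ≤ delta R X + 1 := by
  rw [hR.delta_eq_s19 (A := X ∪ {a}) subset_rfl,
    hR.delta_eq_s19 (A := X ∪ {a}) (X := X) Finset.subset_union_left]
  have hc : (X ∪ {a}).card = X.card + 1 := by
    rw [Finset.card_union_of_disjoint (by simpa using ha), Finset.card_singleton]
  have hs : ∑ ℓ ∈ linesOf R (X ∪ {a}), (((X ∩ ℓ).card - 2 : ℕ) : ℤ) ≤
      ∑ ℓ ∈ linesOf R (X ∪ {a}), ((((X ∪ {a}) ∩ ℓ).card - 2 : ℕ) : ℤ) := by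
    refine Finset.sum_le_sum fun ℓ _ => ?_
    rw [card_union_singleton_inter ha]
    omega
  omega

theorem delta_union_singleton_le_of_rel (hR : IsLinearSpace R) {X : Finset M} {a b c : M}
    (ha : a ∉ X) (hb : b ∈ X) (hc : c ∈ X) (h : R b c a) :
    delta R (X ∪ {a}) ≤ delta R X := by
  rw [hR.delta_eq_s19 (A := X ∪ {a}) subset_rfl,
    hR.delta_eq_s19 (A := X ∪ {a}) (X := X) Finset.subset_union_left]
  have hcard : (X ∪ {a}).card = X.card + 1 := by
    rw [Finset.card_union_of_disjoint (by simpa using ha), Finset.card_singleton]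
  have hs : ∑ ℓ ∈ linesOf R (X ∪ {a}), (((X ∩ ℓ).card - 2 : ℕ) : ℤ) <
      ∑ ℓ ∈ linesOf R (X ∪ {a}), ((((X ∪ {a}) ∩ ℓ).card - 2 : ℕ) : ℤ) := by
    obtain ⟨ℓ, hℓ, h1, h2, h3⟩ := hR.exists_line (A := X ∪ {a}) (by simp [hb]) (by simp [hc])
      (by simp) h
    refine Finset.sum_lt_sum (fun ℓ _ => ?_) ⟨ℓ, hℓ, ?_⟩
    · rw [card_union_singleton_inter ha]
      omega
    · have : 2 ≤ (X ∩ ℓ).card := Finset.one_lt_card.2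
        ⟨b, Finset.mem_inter.2 ⟨hb, h1⟩, c, Finset.mem_inter.2 ⟨hc, h2⟩, hR.ne12 h⟩
      rw [card_union_singleton_inter ha, if_pos h3]
      omega
  omega

theorem exists_rel_of_delta_union_singleton_le (hR : IsLinearSpace R) {X : Finset M} {a : M}
    (ha : a ∉ X) (h : delta R (X ∪ {a}) ≤ delta R X) : ∃ b ∈ X, ∃ c ∈ X, R b c a := by
  by_contra hno
  rw [hR.delta_eq_s19 (A := X ∪ {a}) subset_rfl,
    hR.delta_eq_s19 (A := X ∪ {a}) (X := X) Finset.subset_union_left] at h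
  have hcard : (X ∪ {a}).card = X.card + 1 := by
    rw [Finset.card_union_of_disjoint (by simpa using ha), Finset.card_singleton]
  have hs : ∑ ℓ ∈ linesOf R (X ∪ {a}), ((((X ∪ {a}) ∩ ℓ).card - 2 : ℕ) : ℤ) =
      ∑ ℓ ∈ linesOf R (X ∪ {a}), (((X ∩ ℓ).card - 2 : ℕ) : ℤ) := by
    refine Finset.sum_congr rfl fun ℓ hℓ => ?_
    rw [card_union_singleton_inter ha]
    by_cases h3 : a ∈ ℓ
    · have : (X ∩ ℓ).card ≤ 1 := by
        by_contra h2
        obtain ⟨b, hb, c, hc, hbc⟩ := Finset.one_lt_card.1 (not_le.1 h2)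
        rw [Finset.mem_inter] at hb hc
        exact hno ⟨b, hb.1, c, hc.1, rel_of_mem_line hℓ hb.2 hc.2 h3 hbc
          (fun e => ha (e ▸ hc.1)) (fun e => ha (e ▸ hb.1))⟩
      rw [if_pos h3]
      omega
    · rw [if_neg h3, Nat.add_zero]
  omega

end IsLinearSpace

/-- Every related triple of `S` lies in `E` or in `F`. -/
def SplitsAs (S : M → M → M → Prop) (E F : Finset M) : Prop :=
  ∀ a b c, S a b c → (a ∈ E ∧ b ∈ E ∧ c ∈ E) ∨ (a ∈ F ∧ b ∈ F ∧ c ∈ F)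

theorem SplitsAs.symm {S : M → M → M → Prop} {E F : Finset M} (h : SplitsAs S E F) :
    SplitsAs S F E := fun a b c hs => (h a b c hs).symm

namespace IsLinearSpace

variable {E F : Finset M}

theorem line_subset_of_splits (hsp : SplitsAs R E F) {A ℓ : Finset M} (hℓ : ℓ ∈ linesOf R A) :
    ℓ ⊆ E ∨ ℓ ⊆ F := by
  by_contra hno
  rw [not_or, Finset.not_subset, Finset.not_subset] at hno
  obtain ⟨⟨x, hx, hxE⟩, y, hy, hyF⟩ := hno
  obtain ⟨u, v, w, hu, hv, hw, huv, huw, hvw⟩ :=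
    Finset.two_lt_card_iff.1 (isLineOf_of_mem hℓ).2.1
  have main : ∀ p ∈ ℓ, ∀ q ∈ ℓ, ∀ r ∈ ℓ, p ≠ q → q ≠ r → p ≠ r →
      (p ∈ E ∧ q ∈ E ∧ r ∈ E) ∨ (p ∈ F ∧ q ∈ F ∧ r ∈ F) := fun p hp q hq r hr h1 h2 h3 =>
    hsp _ _ _ (rel_of_mem_line hℓ hp hq hr h1 h2 h3)
  by_cases hxy : x = y
  · subst hxy
    have : ∃ p ∈ ℓ, ∃ q ∈ ℓ, x ≠ p ∧ p ≠ q ∧ x ≠ q := by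
      by_cases h1 : x = u
      · exact ⟨v, hv, w, hw, by grind, hvw, by grind⟩
      · by_cases h2 : x = v
        · exact ⟨u, hu, w, hw, h1, huw, by grind⟩
        · exact ⟨u, hu, v, hv, h1, huv, h2⟩
    obtain ⟨p, hp, q, hq, h1, h2, h3⟩ := this
    have := main x hx p hp q hq h1 h2 h3
    tauto
  · obtain ⟨z, hz, hz'⟩ := Finset.exists_mem_notMem_of_card_lt_card
      (Finset.card_le_two.trans_lt (isLineOf_of_mem hℓ).2.1 : ({x, y} : Finset M).card < ℓ.card)
    have h1 : x ≠ z := fun h => hz' (by simp [h])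
    have h2 : y ≠ z := fun h => hz' (by simp [h])
    have := main x hx y hy z hz hxy h2 h1
    tauto

theorem delta_modular (hR : IsLinearSpace R) (hsp : SplitsAs R E F) {X : Finset M}
    (hX : X ⊆ E ∪ F) :
    delta R X + delta R (X ∩ (E ∩ F)) = delta R (X ∩ E) + delta R (X ∩ F) := by
  rw [hR.delta_eq_s19 (A := E ∪ F) hX,
    hR.delta_eq_s19 (A := E ∪ F) (X := X ∩ (E ∩ F)) (Finset.inter_subset_left.trans hX),
    hR.delta_eq_s19 (A := E ∪ F) (X := X ∩ E) (Finset.inter_subset_left.trans hX),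
    hR.delta_eq_s19 (A := E ∪ F) (X := X ∩ F) (Finset.inter_subset_left.trans hX)]
  have hc : X.card + (X ∩ (E ∩ F)).card = (X ∩ E).card + (X ∩ F).card := by
    rw [← Finset.card_union_add_card_inter (X ∩ E) (X ∩ F), ← Finset.inter_union_distrib_left,
      Finset.inter_eq_left.2 hX, ← Finset.inter_inter_distrib_left]
  have hs : ∑ ℓ ∈ linesOf R (E ∪ F), (((X ∩ ℓ).card - 2 : ℕ) : ℤ) +
      ∑ ℓ ∈ linesOf R (E ∪ F), (((X ∩ (E ∩ F) ∩ ℓ).card - 2 : ℕ) : ℤ) =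
      ∑ ℓ ∈ linesOf R (E ∪ F), (((X ∩ E ∩ ℓ).card - 2 : ℕ) : ℤ) +
      ∑ ℓ ∈ linesOf R (E ∪ F), (((X ∩ F ∩ ℓ).card - 2 : ℕ) : ℤ) := by
    rw [← Finset.sum_add_distrib, ← Finset.sum_add_distrib]
    refine Finset.sum_congr rfl fun ℓ hℓ => ?_
    rcases line_subset_of_splits hsp hℓ with h | h
    · rw [show X ∩ E ∩ ℓ = X ∩ ℓ by grind, show X ∩ (E ∩ F) ∩ ℓ = X ∩ F ∩ ℓ by grind]
    · rw [show X ∩ F ∩ ℓ = X ∩ ℓ by grind, show X ∩ (E ∩ F) ∩ ℓ = X ∩ E ∩ ℓ by grind, add_comm]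
  omega

theorem strong_of_splits (hR : IsLinearSpace R) (hsp : SplitsAs R E F)
    (hF : Strong R (E ∩ F) F) : Strong R E (E ∪ F) := by
  refine ⟨Finset.subset_union_left, fun X h1 h2 => ?_⟩
  have h := hR.delta_modular hsp h2
  have h3 := hF.2 (X ∩ F) (Finset.inter_subset_inter_right h1) Finset.inter_subset_right
  rw [show X ∩ E = E by grind, show X ∩ (E ∩ F) = E ∩ F by grind] at h
  omega

theorem inK0_of_splits (hR : IsLinearSpace R) (hsp : SplitsAs R E F)
    (hF : Strong R (E ∩ F) F) (hE : InK0 R E) : InK0 R (E ∪ F) := fun X hX => by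
  have h1 := hR.delta_modular hsp hX
  have h2 := hE (X ∩ E) Finset.inter_subset_right
  have h3 := hR.strong_inter_le hF (X := X ∩ F) Finset.inter_subset_right
  rw [show X ∩ F ∩ (E ∩ F) = X ∩ (E ∩ F) by grind] at h3
  omega

end IsLinearSpace

end Submodularity

section GoodPairsInSplit

variable {M : Type*} {R : M → M → M → Prop} {B C E F : Finset M}

namespace IsLinearSpace

theorem delta_add_one_le_of_goodPair (hR : IsLinearSpace R) (h : GoodPair R B C)
    {B' : Finset M} (hB' : B' ⊂ B) : delta R B' + 1 ≤ delta R (B' ∪ C) := by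
  obtain ⟨h1, h2⟩ := h
  rw [zeroPrimOver_iff] at h1
  obtain ⟨hdis, hne, hδ, hprim⟩ := h1
  have key : ∀ X ⊆ C, delta R (B ∪ X) + delta R B' ≤ delta R (B' ∪ X) + delta R B := fun X hX =>
    hR.delta_union_le hB'.1 (by
      rw [Finset.disjoint_iff_inter_eq_empty.1 (hdis.mono_right hX)]; exact Finset.empty_subset _)
  have hC := key C subset_rfl
  by_contra hlt
  refine h2 B' hB' ?_
  rw [zeroPrimOver_iff]
  refine ⟨hdis.mono_left hB'.1, hne, by omega, fun X hX hXne => ?_⟩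
  have := key X hX.1
  have := hprim X hX hXne
  omega

theorem base_subset_of_goodPair (hR : IsLinearSpace R) (hsp : SplitsAs R E F)
    (h : GoodPair R B C) (hB : B ⊆ E ∪ F) (hC : C ⊆ E \ F) : B ⊆ E := by
  by_contra hno
  have h1 := hR.delta_modular hsp hB
  have h2 := hR.delta_modular hsp (X := B ∪ C)
    (Finset.union_subset hB (hC.trans (Finset.sdiff_subset.trans Finset.subset_union_left)))
  have h3 := hR.delta_add_one_le_of_goodPair h (B' := B ∩ E)
    ⟨Finset.inter_subset_left, fun hs => hno (hs.trans Finset.inter_subset_right)⟩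
  have h4 := (zeroPrimOver_iff.1 h.1).2.2.1
  rw [show (B ∪ C) ∩ (E ∩ F) = B ∩ (E ∩ F) by grind, show (B ∪ C) ∩ E = B ∩ E ∪ C by grind,
    show (B ∪ C) ∩ F = B ∩ F by grind] at h2
  omega

theorem zeroPrimOver_dichotomy (hR : IsLinearSpace R) (hF : Strong R F (E ∪ F))
    (h : ZeroPrimOver R B C) (hB : B ⊆ F) (hC : C ⊆ E ∪ F) : C ⊆ F ∨ C ⊆ E \ F := by
  by_contra hno
  rw [not_or] at hno
  obtain ⟨hdis, -, hδ, hprim⟩ := zeroPrimOver_iff.1 h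
  have h1 := hprim (C ∩ F)
    ⟨Finset.inter_subset_left, fun hs => hno.1 (hs.trans Finset.inter_subset_right)⟩ (by
      rw [Finset.nonempty_iff_ne_empty]
      intro he
      refine hno.2 fun x hx => ?_
      have := hC hx
      have : x ∉ C ∩ F := by rw [he]; exact Finset.notMem_empty x
      grind)
  have h2 := hR.delta_union_le (X := B ∪ (C ∩ F)) (Y := F) (Z := C \ F) (by grind) (by grind)
  have h3 := hF.2 (F ∪ (C \ F)) Finset.subset_union_left (by grind)
  rw [show B ∪ C ∩ F ∪ C \ F = B ∪ C by grind] at h2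
  omega

end IsLinearSpace

end GoodPairsInSplit

section CountingCopies

theorem sum_trunc_add_le {ι : Type*} (b : ℕ) (c : ι → ℕ) (s : Finset ι) :
    ∑ i ∈ s, (((b + c i - 2 : ℕ) : ℤ) - ((b - 2 : ℕ) : ℤ)) + ((b - 2 : ℕ) : ℤ) ≤
      ((b + ∑ i ∈ s, c i - 2 : ℕ) : ℤ) := by
  induction s using Finset.induction with
  | empty => simp
  | insert a s ha ih =>
    rw [Finset.sum_insert ha, Finset.sum_insert ha]
    omega

theorem sum_trunc_one_add_le {ι : Type*} (c : ι → ℕ) (s : Finset ι) :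
    ∑ i ∈ s, (1 + c i - 2) + ((s.filter fun i => 2 ≤ c i).card - 1) ≤ 1 + ∑ i ∈ s, c i - 2 ∧
      (s.filter fun i => 2 ≤ c i).card ≤ ∑ i ∈ s, c i ∧
      ∑ i ∈ s, (1 + c i - 2) ≤ ∑ i ∈ s, c i := by
  induction s using Finset.induction with
  | empty => simp
  | insert a s ha ih =>
    rw [Finset.sum_insert ha, Finset.sum_insert ha, Finset.filter_insert]
    split_ifs with h
    · rw [Finset.card_insert_of_notMem (by simp [ha])]
      omega
    · omega

variable {M : Type*} {R : M → M → M → Prop} {B C E F : Finset M}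

namespace IsLinearSpace

theorem card_inter_line_le_one (hR : IsLinearSpace R) (h : ZeroPrimOver R B C)
    (hC : 2 ≤ C.card) {A ℓ : Finset M} (hℓ : ℓ ∈ linesOf R A) (hne : (C ∩ ℓ).Nonempty) :
    (B ∩ ℓ).card ≤ 1 := by
  by_contra hlt
  obtain ⟨hdis, -, -, hprim⟩ := zeroPrimOver_iff.1 h
  obtain ⟨x, hx, y, hy, hxy⟩ := Finset.one_lt_card.1 (not_le.1 hlt)
  obtain ⟨z, hz⟩ := hne
  rw [Finset.mem_inter] at hx hy hz
  have hzB : z ∉ B := fun hb => Finset.disjoint_left.1 hdis hb hz.1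
  have h1 := hprim {z} (Finset.ssubset_iff_subset_ne.2
    ⟨by simpa using hz.1, fun he => by rw [← he, Finset.card_singleton] at hC; omega⟩)
    (Finset.singleton_nonempty z)
  have h2 := hR.delta_union_singleton_le_of_rel hzB hx.1 hy.1
    (rel_of_mem_line hℓ hx.2 hy.2 hz.2 hxy (fun e => hzB (e ▸ hy.1)) (fun e => hzB (e ▸ hx.1)))
  omega

/-- Pairwise disjoint extensions of `B` of relative predimension `0` that share lines meeting `B`
in a single point lower the predimension of their union with `B`. -/
theorem sum_excess_le (hR : IsLinearSpace R) {A : Finset M} (hB : B ⊆ A)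
    {𝒞 : Finset (Finset M)} (hsub : ∀ C ∈ 𝒞, C ⊆ A) (hdisj : ∀ C ∈ 𝒞, Disjoint B C)
    (hδ : ∀ C ∈ 𝒞, delta R (B ∪ C) = delta R B)
    (hpair : ∀ C₁ ∈ 𝒞, ∀ C₂ ∈ 𝒞, C₁ ≠ C₂ → Disjoint C₁ C₂) (h0 : InK0 R A)
    {Q : Finset (Finset M)} (hQ : Q ⊆ linesOf R A) (hQ1 : ∀ ℓ ∈ Q, (B ∩ ℓ).card = 1) :
    ∑ ℓ ∈ Q, (((𝒞.filter fun C => 2 ≤ (C ∩ ℓ).card).card - 1 : ℕ) : ℤ) ≤ delta R B := by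
  have hU : B ∪ 𝒞.biUnion id ⊆ A := Finset.union_subset hB (Finset.biUnion_subset.2 hsub)
  have h1 := h0 _ hU
  have hpw : (𝒞 : Set (Finset M)).PairwiseDisjoint id := fun C₁ h₁ C₂ h₂ h => hpair C₁ h₁ C₂ h₂ h
  have hdU : Disjoint B (𝒞.biUnion id) := (Finset.disjoint_biUnion_right _ _ _).2 hdisj
  have hcU : ∀ ℓ, ((B ∪ 𝒞.biUnion id) ∩ ℓ).card = (B ∩ ℓ).card + ∑ C ∈ 𝒞, (C ∩ ℓ).card := by
    intro ℓ
    rw [Finset.union_inter_distrib_right, Finset.card_union_of_disjoint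
      (hdU.mono Finset.inter_subset_left Finset.inter_subset_left), Finset.biUnion_inter,
      Finset.card_biUnion]
    · rfl
    · exact fun C₁ h₁ C₂ h₂ h =>
        (hpair C₁ h₁ C₂ h₂ h).mono Finset.inter_subset_left Finset.inter_subset_left
  have hcC : ∀ C ∈ 𝒞, ∀ ℓ, ((B ∪ C) ∩ ℓ).card = (B ∩ ℓ).card + (C ∩ ℓ).card := by
    intro C hC ℓ
    rw [Finset.union_inter_distrib_right, Finset.card_union_of_disjoint
      ((hdisj C hC).mono Finset.inter_subset_left Finset.inter_subset_left)]
  have hC : ∀ C ∈ 𝒞, (C.card : ℤ) = ∑ ℓ ∈ linesOf R A,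
      (((((B ∩ ℓ).card + (C ∩ ℓ).card) - 2 : ℕ) : ℤ) - (((B ∩ ℓ).card - 2 : ℕ) : ℤ)) := by
    intro C hC
    have h2 := hδ C hC
    rw [hR.delta_eq_s19 hB, hR.delta_eq_s19 (Finset.union_subset hB (hsub C hC)),
      Finset.card_union_of_disjoint (hdisj C hC)] at h2
    simp only [hcC C hC] at h2
    rw [Finset.sum_sub_distrib]
    push_cast at h2 ⊢
    omega
  rw [hR.delta_eq_s19 hU, Finset.card_union_of_disjoint hdU, Finset.card_biUnion hpw] at h1
  rw [hR.delta_eq_s19 hB]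
  simp only [hcU] at h1
  push_cast at h1
  simp only [id] at h1
  rw [Finset.sum_congr rfl hC, Finset.sum_comm] at h1
  have hw : ∑ ℓ ∈ linesOf R A, (if ℓ ∈ Q then
      (((𝒞.filter fun C => 2 ≤ (C ∩ ℓ).card).card - 1 : ℕ) : ℤ) else 0) =
      ∑ ℓ ∈ Q, (((𝒞.filter fun C => 2 ≤ (C ∩ ℓ).card).card - 1 : ℕ) : ℤ) := by
    rw [← Finset.sum_filter]
    refine Finset.sum_congr ?_ fun _ _ => rfl
    ext ℓ
    simp only [Finset.mem_filter]
    exact ⟨fun h => h.2, fun h => ⟨hQ h, h⟩⟩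
  have hlines : ∑ ℓ ∈ linesOf R A, ((∑ C ∈ 𝒞,
      (((((B ∩ ℓ).card + (C ∩ ℓ).card) - 2 : ℕ) : ℤ) - (((B ∩ ℓ).card - 2 : ℕ) : ℤ))) +
      (((B ∩ ℓ).card - 2 : ℕ) : ℤ) + (if ℓ ∈ Q then
      (((𝒞.filter fun C => 2 ≤ (C ∩ ℓ).card).card - 1 : ℕ) : ℤ) else 0)) ≤
      ∑ ℓ ∈ linesOf R A, (((B ∩ ℓ).card + ∑ C ∈ 𝒞, (C ∩ ℓ).card - 2 : ℕ) : ℤ) := by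
    refine Finset.sum_le_sum fun ℓ _ => ?_
    split_ifs with hℓ
    · rw [hQ1 ℓ hℓ]
      have := (sum_trunc_one_add_le (fun C : Finset M => (C ∩ ℓ).card) 𝒞).1
      zify at this
      simpa using this
    · simpa using sum_trunc_add_le (B ∩ ℓ).card (fun C : Finset M => (C ∩ ℓ).card) 𝒞
  rw [Finset.sum_add_distrib, Finset.sum_add_distrib, hw] at hlines
  omega

end IsLinearSpace

/-- The lines of `E ∪ F` that meet `B` in exactly one point, lying in `E \ F`, and that have at
least two points in `E ∩ F`. -/
noncomputable def exposedLines (R : M → M → M → Prop) (B E F : Finset M) : Finset (Finset M) :=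
  (linesOf R (E ∪ F)).filter fun ℓ => (B ∩ ℓ).card = 1 ∧ (B ∩ E ∩ ℓ).card = 1 ∧
    (B ∩ (E ∩ F) ∩ ℓ).card = 0 ∧ 2 ≤ (E ∩ F ∩ ℓ).card

theorem disjoint_exposedLines : Disjoint (exposedLines R B E F) (exposedLines R B F E) := by
  rw [Finset.disjoint_left]
  intro ℓ h1 h2
  simp only [exposedLines, Finset.mem_filter] at h1 h2
  have h := Finset.card_union_add_card_inter (B ∩ E ∩ ℓ) (B ∩ F ∩ ℓ)
  rw [show B ∩ E ∩ ℓ ∩ (B ∩ F ∩ ℓ) = B ∩ (E ∩ F) ∩ ℓ by grind] at h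
  have h3 : (B ∩ E ∩ ℓ ∪ B ∩ F ∩ ℓ).card ≤ (B ∩ ℓ).card := Finset.card_le_card (by grind)
  omega

namespace IsLinearSpace

theorem delta_add_card_exposedLines_le (hR : IsLinearSpace R) :
    delta R (E ∩ F ∪ B ∩ E) + delta R (B ∩ (E ∩ F)) + (exposedLines R B E F).card ≤
      delta R (B ∩ E) + delta R (E ∩ F) := by
  have hD : E ∩ F ⊆ E ∪ F := Finset.inter_subset_left.trans Finset.subset_union_left
  have hBE : B ∩ E ⊆ E ∪ F := Finset.inter_subset_right.trans Finset.subset_union_left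
  rw [hR.delta_eq_s19 (Finset.union_subset hD hBE),
    hR.delta_eq_s19 (Finset.inter_subset_right.trans hD : B ∩ (E ∩ F) ⊆ E ∪ F), hR.delta_eq_s19 hBE,
    hR.delta_eq_s19 hD]
  have hc := Finset.card_union_add_card_inter (E ∩ F) (B ∩ E)
  rw [show E ∩ F ∩ (B ∩ E) = B ∩ (E ∩ F) by grind] at hc
  have hs : ∑ ℓ ∈ linesOf R (E ∪ F), (((B ∩ E ∩ ℓ).card - 2 : ℕ) : ℤ) +
      ∑ ℓ ∈ linesOf R (E ∪ F), (((E ∩ F ∩ ℓ).card - 2 : ℕ) : ℤ) +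
      (exposedLines R B E F).card ≤
      ∑ ℓ ∈ linesOf R (E ∪ F), ((((E ∩ F ∪ B ∩ E) ∩ ℓ).card - 2 : ℕ) : ℤ) +
      ∑ ℓ ∈ linesOf R (E ∪ F), (((B ∩ (E ∩ F) ∩ ℓ).card - 2 : ℕ) : ℤ) := by
    rw [exposedLines, Finset.card_filter]
    push_cast
    rw [← Finset.sum_add_distrib, ← Finset.sum_add_distrib, ← Finset.sum_add_distrib]
    refine Finset.sum_le_sum fun ℓ _ => ?_
    have h1 := Finset.card_union_add_card_inter (E ∩ F ∩ ℓ) (B ∩ E ∩ ℓ)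
    rw [← Finset.union_inter_distrib_right,
      show E ∩ F ∩ ℓ ∩ (B ∩ E ∩ ℓ) = B ∩ (E ∩ F) ∩ ℓ by grind] at h1
    have h2 : (B ∩ (E ∩ F) ∩ ℓ).card ≤ (B ∩ E ∩ ℓ).card := Finset.card_le_card (by grind)
    have h3 : (B ∩ (E ∩ F) ∩ ℓ).card ≤ (E ∩ F ∩ ℓ).card := Finset.card_le_card (by grind)
    split_ifs <;> omega
  omega

theorem exists_exposedLine (hR : IsLinearSpace R) (hsp : SplitsAs R E F) (h : GoodPair R B C)
    (hB : B ⊆ E ∪ F) (hBF : ¬ B ⊆ F) (hC : C ⊆ F) (hC2 : 2 ≤ C.card) :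
    ∃ ℓ ∈ exposedLines R B E F, 2 ≤ (C ∩ ℓ).card := by
  have hdis := h.1.1
  have h1 := hR.delta_modular hsp hB
  have h2 := hR.delta_modular hsp (X := B ∪ C)
    (Finset.union_subset hB (hC.trans Finset.subset_union_right))
  have h3 := hR.delta_add_one_le_of_goodPair h (B' := B ∩ F)
    ⟨Finset.inter_subset_left, fun hs => hBF (hs.trans Finset.inter_subset_right)⟩
  rw [show (B ∪ C) ∩ (E ∩ F) = B ∩ (E ∩ F) ∪ C ∩ E by grind,
    show (B ∪ C) ∩ E = B ∩ E ∪ C ∩ E by grind,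
    show (B ∪ C) ∩ F = B ∩ F ∪ C by grind, (zeroPrimOver_iff.1 h.1).2.2.1] at h2
  have h4 : delta R (B ∩ E ∪ C ∩ E) + delta R (B ∩ (E ∩ F)) <
    delta R (B ∩ (E ∩ F) ∪ C ∩ E) + delta R (B ∩ E) := by omega
  rw [hR.delta_eq_s19 (A := E ∪ F) (X := B ∩ E ∪ C ∩ E) (by grind),
    hR.delta_eq_s19 (A := E ∪ F) (X := B ∩ (E ∩ F)) (by grind),
    hR.delta_eq_s19 (A := E ∪ F) (X := B ∩ (E ∩ F) ∪ C ∩ E) (by grind),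
    hR.delta_eq_s19 (A := E ∪ F) (X := B ∩ E) (by grind),
    Finset.card_union_of_disjoint
      (hdis.mono Finset.inter_subset_left Finset.inter_subset_left),
    Finset.card_union_of_disjoint
      (hdis.mono Finset.inter_subset_left Finset.inter_subset_left)] at h4
  have h5 : ∑ ℓ ∈ linesOf R (E ∪ F), ((((B ∩ (E ∩ F) ∪ C ∩ E) ∩ ℓ).card - 2 : ℕ) +
        ((B ∩ E ∩ ℓ).card - 2 : ℕ) : ℤ) <
      ∑ ℓ ∈ linesOf R (E ∪ F), ((((B ∩ E ∪ C ∩ E) ∩ ℓ).card - 2 : ℕ) +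
        ((B ∩ (E ∩ F) ∩ ℓ).card - 2 : ℕ) : ℤ) := by
    rw [Finset.sum_add_distrib, Finset.sum_add_distrib]
    push_cast at h4 ⊢
    omega
  obtain ⟨ℓ, hℓ, h6⟩ := Finset.exists_lt_of_sum_lt h5
  rw [Finset.union_inter_distrib_right, Finset.union_inter_distrib_right,
    Finset.card_union_of_disjoint (hdis.mono (by grind) (by grind)),
    Finset.card_union_of_disjoint (hdis.mono (by grind) (by grind))] at h6
  have h7 : (B ∩ (E ∩ F) ∩ ℓ).card ≤ (B ∩ E ∩ ℓ).card := Finset.card_le_card (by grind)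
  have h8 : (B ∩ E ∩ ℓ).card ≤ (B ∩ ℓ).card := Finset.card_le_card (by grind)
  have h9 : (C ∩ E ∩ ℓ).card ≤ (E ∩ F ∩ ℓ).card := Finset.card_le_card (by grind)
  have h10 : (C ∩ E ∩ ℓ).card ≤ (C ∩ ℓ).card := Finset.card_le_card (by grind)
  have h11 : (B ∩ ℓ).card ≤ 1 := hR.card_inter_line_le_one h.1 hC2 hℓ
    (Finset.card_pos.1 (by omega))
  refine ⟨ℓ, Finset.mem_filter.2 ⟨hℓ, ?_⟩, ?_⟩ <;> omega

theorem delta_inter_add_card_le (hR : IsLinearSpace R) (hsp : SplitsAs R E F)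
    (hE : Strong R (E ∩ F) E) (hB : B ⊆ E ∪ F) (hBE : ¬ B ⊆ E) {𝒞 : Finset (Finset M)}
    (hgood : ∀ C ∈ 𝒞, GoodPair R B C) (hsub : ∀ C ∈ 𝒞, C ⊆ E ∪ F) (hnot : ∀ C ∈ 𝒞, ¬ C ⊆ F)
    (hpair : ∀ C₁ ∈ 𝒞, ∀ C₂ ∈ 𝒞, C₁ ≠ C₂ → Disjoint C₁ C₂) :
    delta R (E ∩ F) + 𝒞.card ≤ delta R (E ∩ F ∪ B ∩ E) := by
  have hstep : ∀ C ∈ 𝒞, ∀ W, E ∩ F ∪ B ∩ E ⊆ W → Disjoint W (C \ F) →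
      delta R (W ∪ C \ F) + 1 ≤ delta R W := by
    intro C hC W hW hdis
    obtain ⟨-, -, hδ, hprim⟩ := zeroPrimOver_iff.1 (hgood C hC).1
    have hCs := hsub C hC
    have h1 := hprim (C ∩ F)
      ⟨Finset.inter_subset_left, fun hs => hnot C hC (hs.trans Finset.inter_subset_right)⟩ (by
        rw [Finset.nonempty_iff_ne_empty]
        intro he
        refine hBE (hR.base_subset_of_goodPair hsp (hgood C hC) hB fun x hx => ?_)
        have := hCs hx
        have : x ∉ C ∩ F := by rw [he]; exact Finset.notMem_empty x
        grind)
    have h2 := hR.delta_modular hsp (X := B ∪ C) (Finset.union_subset hB hCs)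
    have h3 := hR.delta_modular hsp (X := B ∪ C ∩ F) (by grind)
    rw [show (B ∪ C ∩ F) ∩ (E ∩ F) = (B ∪ C) ∩ (E ∩ F) by grind,
      show (B ∪ C ∩ F) ∩ F = (B ∪ C) ∩ F by grind] at h3
    have h4 := hR.delta_union_le (X := (B ∪ C ∩ F) ∩ E) (Y := W) (Z := C \ F) (by grind)
      (by rw [Finset.disjoint_iff_inter_eq_empty.1 hdis]; exact Finset.empty_subset _)
    rw [show (B ∪ C ∩ F) ∩ E ∪ C \ F = (B ∪ C) ∩ E by grind] at h4
    omega
  have hind : ∀ s ⊆ 𝒞, delta R (E ∩ F ∪ B ∩ E ∪ s.biUnion (fun C => C \ F)) + s.card ≤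
      delta R (E ∩ F ∪ B ∩ E) := by
    intro s
    induction s using Finset.induction with
    | empty => simp
    | insert C s hCs ih =>
      intro hs
      have hC := hs (Finset.mem_insert_self C s)
      have h1 := ih ((Finset.subset_insert C s).trans hs)
      have h2 := hstep C hC (E ∩ F ∪ B ∩ E ∪ s.biUnion (fun C => C \ F))
        Finset.subset_union_left (by
          rw [Finset.disjoint_union_left, Finset.disjoint_biUnion_left]
          refine ⟨?_, fun C' hC' => (hpair C' (hs (Finset.mem_insert_of_mem hC')) C hC
            fun e => hCs (e ▸ hC')).mono Finset.sdiff_subset Finset.sdiff_subset⟩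
          have := Finset.disjoint_left.1 (hgood C hC).1.1
          rw [Finset.disjoint_left]
          grind)
      rw [Finset.biUnion_insert, Finset.card_insert_of_notMem hCs, Finset.union_comm (C \ F),
        ← Finset.union_assoc]
      push_cast
      omega
  have h1 := hind 𝒞 subset_rfl
  have h2 := hE.2 (E ∩ F ∪ B ∩ E ∪ 𝒞.biUnion (fun C => C \ F))
    (Finset.subset_union_left.trans Finset.subset_union_left) (by
      refine Finset.union_subset (by grind) (Finset.biUnion_subset.2 fun C hC => ?_)
      have := hsub C hC
      grind)
  omega

theorem card_add_card_exposedLines_le (hR : IsLinearSpace R) (hsp : SplitsAs R E F)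
    (hE : Strong R (E ∩ F) E) (hB : B ⊆ E ∪ F) (hBE : ¬ B ⊆ E) (hBF : ¬ B ⊆ F)
    {𝒞 : Finset (Finset M)} (hgood : ∀ C ∈ 𝒞, GoodPair R B C) (hsub : ∀ C ∈ 𝒞, C ⊆ E ∪ F)
    (hC2 : ∀ C ∈ 𝒞, 2 ≤ C.card)
    (hpair : ∀ C₁ ∈ 𝒞, ∀ C₂ ∈ 𝒞, C₁ ≠ C₂ → Disjoint C₁ C₂) :
    (𝒞.card : ℤ) + delta R (B ∩ (E ∩ F)) ≤ delta R (B ∩ E) + ∑ ℓ ∈ exposedLines R B E F,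
      (((𝒞.filter fun C => 2 ≤ (C ∩ ℓ).card).card - 1 : ℕ) : ℤ) := by
  have h1 := hR.delta_inter_add_card_le hsp hE hB hBE (𝒞 := 𝒞.filter fun C => ¬ C ⊆ F)
    (fun C hC => hgood C (Finset.mem_filter.1 hC).1)
    (fun C hC => hsub C (Finset.mem_filter.1 hC).1) (fun C hC => (Finset.mem_filter.1 hC).2)
    (fun C₁ h₁ C₂ h₂ => hpair C₁ (Finset.mem_filter.1 h₁).1 C₂ (Finset.mem_filter.1 h₂).1)
  have h2 := hR.delta_add_card_exposedLines_le (B := B) (E := E) (F := F)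
  have h3 : (𝒞.filter fun C => C ⊆ F).card ≤
      ∑ ℓ ∈ exposedLines R B E F, (𝒞.filter fun C => 2 ≤ (C ∩ ℓ).card).card := by
    refine (Finset.card_le_card fun C hC => ?_).trans Finset.card_biUnion_le
    obtain ⟨hC, hCF⟩ := Finset.mem_filter.1 hC
    obtain ⟨ℓ, hℓ, h⟩ := hR.exists_exposedLine hsp (hgood C hC) hB hBF hCF (hC2 C hC)
    exact Finset.mem_biUnion.2 ⟨ℓ, hℓ, Finset.mem_filter.2 ⟨hC, h⟩⟩
  have h4 : ∑ ℓ ∈ exposedLines R B E F, (𝒞.filter fun C => 2 ≤ (C ∩ ℓ).card).card ≤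
      ∑ ℓ ∈ exposedLines R B E F, ((𝒞.filter fun C => 2 ≤ (C ∩ ℓ).card).card - 1) +
        (exposedLines R B E F).card := by
    rw [Finset.card_eq_sum_ones, ← Finset.sum_add_distrib]
    exact Finset.sum_le_sum fun ℓ _ => by omega
  have h5 := Finset.card_filter_add_card_filter_not (s := 𝒞) (fun C => C ⊆ F)
  push_cast [← Nat.cast_sum]
  omega

/-- A base contained in neither factor has at most `δ(B)` disjoint extensions in a good pair. -/
theorem card_le_delta_of_not_subset (hR : IsLinearSpace R) (hsp : SplitsAs R E F)
    (hE : Strong R (E ∩ F) E) (hF : Strong R (E ∩ F) F) (h0 : InK0 R (E ∪ F)) (hB : B ⊆ E ∪ F)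
    (hBE : ¬ B ⊆ E) (hBF : ¬ B ⊆ F) {𝒞 : Finset (Finset M)}
    (hgood : ∀ C ∈ 𝒞, GoodPair R B C) (hsub : ∀ C ∈ 𝒞, C ⊆ E ∪ F) (hC2 : ∀ C ∈ 𝒞, 2 ≤ C.card)
    (hpair : ∀ C₁ ∈ 𝒞, ∀ C₂ ∈ 𝒞, C₁ ≠ C₂ → Disjoint C₁ C₂) : (𝒞.card : ℤ) ≤ delta R B := by
  have h1 := hR.card_add_card_exposedLines_le hsp hE hB hBE hBF hgood hsub hC2 hpair
  have h2 := hR.card_add_card_exposedLines_le hsp.symm (by rwa [Finset.inter_comm])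
    (by rwa [Finset.union_comm]) hBF hBE hgood (by rwa [Finset.union_comm]) hC2 hpair
  have h3 := hR.sum_excess_le hB hsub (fun C hC => (hgood C hC).1.1)
    (fun C hC => (hgood C hC).1.2.2.2) hpair h0
    (Q := exposedLines R B E F ∪ exposedLines R B F E)
    (Finset.union_subset (Finset.filter_subset _ _) (by
      rw [exposedLines, Finset.union_comm F E]; exact Finset.filter_subset _ _))
    (fun ℓ hℓ => by
      rcases Finset.mem_union.1 hℓ with h | h <;> exact (Finset.mem_filter.1 h).2.1)
  rw [Finset.sum_union disjoint_exposedLines] at h3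
  have h4 := hR.delta_modular hsp hB
  have h5 := h0 (B ∩ (E ∩ F)) (Finset.inter_subset_left.trans hB)
  rw [Finset.inter_comm F E] at h2
  omega

/-- A one-point extension in a good pair has its base in one of the factors. -/
theorem base_subset_of_goodPair_singleton (hR : IsLinearSpace R) (hsp : SplitsAs R E F)
    (hB : B ⊆ E ∪ F) {c : M} (hc : c ∈ E ∪ F) (h : GoodPair R B {c}) : B ⊆ E ∨ B ⊆ F := by
  by_contra hno
  rw [not_or] at hno
  by_cases hcE : c ∈ E
  · by_cases hcF : c ∈ F
    · have hcB : c ∉ B := fun hb => Finset.disjoint_left.1 h.1.1 hb (Finset.mem_singleton_self c)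
      have h1 := hR.delta_modular hsp hB
      have h2 := hR.delta_modular hsp (X := B ∪ {c})
        (Finset.union_subset hB (Finset.singleton_subset_iff.2 hc))
      have h3 := hR.delta_add_one_le_of_goodPair h (B' := B ∩ E)
        ⟨Finset.inter_subset_left, fun hs => hno.1 (hs.trans Finset.inter_subset_right)⟩
      have h4 := hR.delta_add_one_le_of_goodPair h (B' := B ∩ F)
        ⟨Finset.inter_subset_left, fun hs => hno.2 (hs.trans Finset.inter_subset_right)⟩
      have h5 := hR.delta_union_singleton_le (X := B ∩ (E ∩ F)) (a := c)
        (fun h => hcB (Finset.mem_inter.1 h).1)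
      rw [show (B ∪ {c}) ∩ (E ∩ F) = B ∩ (E ∩ F) ∪ {c} by grind,
        show (B ∪ {c}) ∩ E = B ∩ E ∪ {c} by grind, show (B ∪ {c}) ∩ F = B ∩ F ∪ {c} by grind,
        h.1.2.2.2] at h2
      omega
    · exact hno.1 (hR.base_subset_of_goodPair hsp h hB (by simp [hcE, hcF]))
  · have hcF : c ∈ F := (Finset.mem_union.1 hc).resolve_left hcE
    exact hno.2 (hR.base_subset_of_goodPair hsp.symm h (by rwa [Finset.union_comm])
      (by simp [hcE, hcF]))

end IsLinearSpace

end CountingCopies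

section Multiplicity

theorem MuInU.nonneg {μ : ∀ P : Type u, (P → P → P → Prop) → Finset P → Finset P → ℤ}
    (hμ : MuInU μ) {P : Type u} {T : P → P → P → Prop} {B C : Finset P}
    (hl : IsLinearSpace (RestrictLS T (B ∪ C))) (h0 : InK0 T (B ∪ C)) (hg : GoodPair T B C) :
    0 ≤ μ P T B C := by
  by_cases hC : 2 ≤ C.card
  · exact (h0 B Finset.subset_union_left).trans (hμ.2.1 P T B C hl h0 hg hC)
  obtain ⟨hdis, hne, hδ, -⟩ := zeroPrimOver_iff.1 hg.1
  obtain ⟨x, rfl⟩ : ∃ x, C = {x} :=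
    Finset.card_eq_one.1 (by have := Finset.card_pos.2 hne; omega)
  have hxB : x ∉ B := fun h => Finset.disjoint_left.1 hdis h (Finset.mem_singleton_self x)
  have hcongr : ∀ A ⊆ B ∪ {x}, delta T A = delta (RestrictLS T (B ∪ {x})) A := fun A hA =>
    delta_congr fun a ha b hb c hc =>
      ⟨fun h => ⟨hA ha, hA hb, hA hc, h⟩, fun h => h.2.2.2⟩
  rw [hcongr _ subset_rfl, hcongr B Finset.subset_union_left] at hδ
  obtain ⟨b, hb, c, hc, hbc⟩ := hl.exists_rel_of_delta_union_singleton_le hxB hδ.le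
  have hbcB : ({b, c} : Finset P) ⊆ B :=
    Finset.insert_subset hb (Finset.singleton_subset_iff.2 hc)
  have hx : x ∉ ({b, c} : Finset P) := fun h => hxB (hbcB h)
  have hBeq : ({b, c} : Finset P) = B := by
    by_contra hneq
    refine hg.2 {b, c} (Finset.ssubset_iff_subset_ne.2 ⟨hbcB, hneq⟩) (zeroPrimOver_iff.2
      ⟨hdis.mono_left hbcB, hne, ?_, fun X hX hXne => ?_⟩)
    · have h1 := hl.delta_union_singleton_le_of_rel hx (Finset.mem_insert_self b {c})
        (by simp) hbc
      have h2 := hl.delta_union_le (Z := {x}) hbcB (by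
        rw [Finset.disjoint_iff_inter_eq_empty.1 hdis]; exact Finset.empty_subset _)
      rw [hcongr _ (Finset.union_subset_union_left hbcB),
        hcongr _ (hbcB.trans Finset.subset_union_left)]
      omega
    · rw [Finset.ssubset_singleton_iff] at hX
      exact absurd hX hXne.ne_empty
  subst hBeq
  have he : ({b, c} : Finset P) ∪ {x} = {b, c, x} := by
    ext t
    simp
  rw [he] at hl h0
  exact zero_le_one.trans (hμ.2.2 P T b c x hl h0 hg hbc.2.2.2)

variable {N P : Type u} {S : N → N → N → Prop} {T : P → P → P → Prop} {BP CP : Finset P}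
  {e : P → N} {C C' : Finset N}

theorem IsCopyOver.goodPair (h : IsCopyOver T S BP CP e C) (hg : GoodPair T BP CP) :
    GoodPair S (BP.image e) C := by
  obtain ⟨-, φ, hφe, hinj, hC, hiso⟩ := h
  have := hg.image hinj hiso
  rwa [hC, Finset.image_congr (fun x hx => hφe x hx)] at this

theorem IsCopyOver.card_eq (h : IsCopyOver T S BP CP e C) : C.card = CP.card := by
  obtain ⟨-, φ, -, hinj, hC, -⟩ := h
  rw [← hC, card_image_of_subset_injOn hinj Finset.subset_union_right]

theorem IsCopyOver.exists_relIsoOn (h : IsCopyOver T S BP CP e C)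
    (h' : IsCopyOver T S BP CP e C') :
    ∃ ψ : N → N, (∀ x ∈ BP.image e, ψ x = x) ∧ Set.InjOn ψ ↑(BP.image e ∪ C) ∧
      C.image ψ = C' ∧ RelIsoOn S S ψ (BP.image e ∪ C) := by
  obtain ⟨-, φ, hφe, hinj, hC, hiso⟩ := h
  obtain ⟨-, φ', hφe', hinj', hC', hiso'⟩ := h'
  by_cases hP : Nonempty P
  · have hinv : ∀ x ∈ BP ∪ CP, Function.invFunOn φ ↑(BP ∪ CP) (φ x) = x := fun x hx =>
      hinj.leftInvOn_invFunOn hx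
    have hU : ∀ y ∈ BP.image e ∪ C, ∃ x ∈ BP ∪ CP, φ x = y := by
      intro y hy
      rw [← hC, ← Finset.image_congr (fun x hx => hφe x hx), ← Finset.image_union] at hy
      exact Finset.mem_image.1 hy
    refine ⟨fun y => φ' (Function.invFunOn φ ↑(BP ∪ CP) y), fun y hy => ?_, ?_, ?_, ?_⟩
    · obtain ⟨x, hx, rfl⟩ := Finset.mem_image.1 hy
      simp only [← hφe x hx]
      rw [hinv x (Finset.mem_union_left _ hx), hφe' x hx, hφe x hx]
    · intro y hy z hz hyz
      obtain ⟨a, ha, rfl⟩ := hU y hy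
      obtain ⟨b, hb, rfl⟩ := hU z hz
      simp only [hinv a ha, hinv b hb] at hyz
      rw [hinj' ha hb hyz]
    · rw [← hC, ← hC', Finset.image_image]
      refine Finset.image_congr fun x hx => ?_
      simp only [Function.comp_apply]
      rw [hinv x (Finset.mem_union_right _ hx)]
    · intro y₁ h₁ y₂ h₂ y₃ h₃
      obtain ⟨a, ha, rfl⟩ := hU y₁ h₁
      obtain ⟨b, hb, rfl⟩ := hU y₂ h₂
      obtain ⟨c, hc, rfl⟩ := hU y₃ h₃
      simp only [hinv a ha, hinv b hb, hinv c hc]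
      exact (hiso a ha b hb c hc).symm.trans (hiso' a ha b hb c hc)
  · have hCP : CP = ∅ := Finset.eq_empty_of_forall_notMem fun x => (hP ⟨x⟩).elim
    have hBP : BP = ∅ := Finset.eq_empty_of_forall_notMem fun x => (hP ⟨x⟩).elim
    subst hCP hBP
    subst hC hC'
    exact ⟨id, by simp, by simp, by simp, fun x hx => by simp at hx⟩

/-- A free amalgam of two members of `K_μ` over a common strong subspace is in `K_μ`, provided no
extension of relative predimension `0` of a base in the intersection is realized on both sides. -/
theorem InKmu.union {μ : ∀ P : Type u, (P → P → P → Prop) → Finset P → Finset P → ℤ}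
    (hμ : MuInU μ) (hS : IsLinearSpace S) {E F : Finset N} (hsp : SplitsAs S E F)
    (hE : Strong S (E ∩ F) E) (hF : Strong S (E ∩ F) F) (hKE : InKmu μ S E) (hKF : InKmu μ S F)
    (hno : ∀ (B C : Finset N) (φ : N → N), B ⊆ E ∩ F → C ⊆ E \ F → C.Nonempty →
      (∀ x ∈ B, φ x = x) → Set.InjOn φ ↑(B ∪ C) → C.image φ ⊆ F \ E →
      RelIsoOn S S φ (B ∪ C) → delta S (B ∪ C) = delta S B → False) :
    InKmu μ S (E ∪ F) := by
  have h0S := hS.inK0_of_splits hsp hF hKE.1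
  have hsF : Strong S F (E ∪ F) := by
    have := hS.strong_of_splits hsp.symm (by rwa [Finset.inter_comm])
    rwa [Finset.union_comm] at this
  have hsE : Strong S E (F ∪ E) := by
    rw [Finset.union_comm]
    exact hS.strong_of_splits hsp hF
  refine ⟨h0S, fun P T BP CP hl h0 hg e he hemem hiso 𝒞 hcopy hdisj => ?_⟩
  have hgood : ∀ C ∈ 𝒞, GoodPair S (BP.image e) C := fun C hC => (hcopy C hC).2.goodPair hg
  have hsub : ∀ C ∈ 𝒞, C ⊆ E ∪ F := fun C hC => (hcopy C hC).1
  have hsub' : ∀ C ∈ 𝒞, C ⊆ F ∪ E := fun C hC => by rw [Finset.union_comm]; exact hsub C hC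
  have hemem' : BP.image e ⊆ F ∪ E := by rwa [Finset.union_comm]
  have inE : BP.image e ⊆ E → (∀ C ∈ 𝒞, C ⊆ E) → (𝒞.card : ℤ) ≤ μ P T BP CP := fun hB hC =>
    hKE.2 P T BP CP hl h0 hg e he hB hiso 𝒞 (fun C h => ⟨hC C h, (hcopy C h).2⟩) hdisj
  by_cases hBF : BP.image e ⊆ F
  · by_cases hall : ∀ C ∈ 𝒞, C ⊆ F
    · exact hKF.2 P T BP CP hl h0 hg e he hBF hiso 𝒞 (fun C h => ⟨hall C h, (hcopy C h).2⟩) hdisj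
    push Not at hall
    obtain ⟨C₀, h₀, hC₀⟩ := hall
    have hC₀ := (hS.zeroPrimOver_dichotomy hsF (hgood C₀ h₀).1 hBF (hsub C₀ h₀)).resolve_left hC₀
    have hBE := hS.base_subset_of_goodPair hsp (hgood C₀ h₀) hemem hC₀
    refine inE hBE fun C₁ h₁ => ?_
    by_contra hC₁
    have hC₁ := (hS.zeroPrimOver_dichotomy hsE (hgood C₁ h₁).1 hBE (hsub' C₁ h₁)).resolve_left hC₁
    obtain ⟨ψ, hψ, hinj, hC, hψiso⟩ := (hcopy C₀ h₀).2.exists_relIsoOn (hcopy C₁ h₁).2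
    exact hno (BP.image e) C₀ ψ (Finset.subset_inter hBE hBF) hC₀ (hgood C₀ h₀).1.2.1 hψ hinj
      (by rwa [hC]) hψiso (hgood C₀ h₀).1.2.2.2
  by_cases hBE : BP.image e ⊆ E
  · refine inE hBE fun C hC => ?_
    exact (hS.zeroPrimOver_dichotomy hsE (hgood C hC).1 hBE (hsub' C hC)).resolve_right
      fun h => hBF (hS.base_subset_of_goodPair hsp.symm (hgood C hC) hemem' h)
  by_cases hCP : 2 ≤ CP.card
  · refine (hS.card_le_delta_of_not_subset hsp hE hF h0S hemem hBE hBF hgood hsub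
      (fun C hC => by rwa [(hcopy C hC).2.card_eq]) hdisj).trans ?_
    rw [delta_image he hiso]
    exact hμ.2.1 P T BP CP hl h0 hg hCP
  · have h𝒞 : 𝒞 = ∅ := by
      refine Finset.eq_empty_of_forall_notMem fun C hC => ?_
      obtain ⟨c, rfl⟩ : ∃ c, C = {c} := Finset.card_eq_one.1 (by
        have := Finset.card_pos.2 (hgood C hC).1.2.1
        have := (hcopy C hC).2.card_eq
        omega)
      rcases hS.base_subset_of_goodPair_singleton hsp hemem
        (Finset.singleton_subset_iff.1 (hsub _ hC)) (hgood _ hC) with h | h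
      · exact hBE h
      · exact hBF h
    rw [h𝒞]
    exact_mod_cast hμ.nonneg hl h0 hg

end Multiplicity

section Extension

variable {M : Type*} {R R' : M → M → M → Prop} {B C D : Finset M}

namespace IsLinearSpace

/-- If `C` has relative predimension at most `0` over `B` and at least `0` over `D ⊇ B`, then every
line joining `C` to `D \ B` is spanned by two points of `B`. -/
theorem exists_pair_of_rel (hR : IsLinearSpace R) (hBD : B ⊆ D) (hCD : Disjoint D C)
    (hBC : delta R (B ∪ C) ≤ delta R B) (hDC : delta R D ≤ delta R (D ∪ C)) {x y z : M}
    (h : R x y z) (hx : x ∈ D ∪ C) (hy : y ∈ D ∪ C) (hz : z ∈ D ∪ C)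
    (hD : ¬ (x ∈ D ∧ y ∈ D ∧ z ∈ D)) (hB : ¬ (x ∈ B ∪ C ∧ y ∈ B ∪ C ∧ z ∈ B ∪ C)) :
    ∃ b₁ ∈ B, ∃ b₂ ∈ B, b₁ ≠ b₂ ∧ (x = b₁ ∨ x = b₂ ∨ R b₁ b₂ x) ∧
      (y = b₁ ∨ y = b₂ ∨ R b₁ b₂ y) ∧ (z = b₁ ∨ z = b₂ ∨ R b₁ b₂ z) := by
  obtain ⟨ℓ, hℓ, hxℓ, hyℓ, hzℓ⟩ := hR.exists_line hx hy hz h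
  have hcard : ∀ k : Finset M, ((B ∪ C) ∩ k).card = (B ∩ k).card + (C ∩ k).card ∧
      ((D ∪ C) ∩ k).card = (D ∩ k).card + (C ∩ k).card ∧ (B ∩ k).card ≤ (D ∩ k).card := by
    intro k
    refine ⟨?_, ?_, Finset.card_le_card (Finset.inter_subset_inter_right hBD)⟩
    · rw [Finset.union_inter_distrib_right, Finset.card_union_of_disjoint
        ((hCD.mono_left hBD).mono Finset.inter_subset_left Finset.inter_subset_left)]
    · rw [Finset.union_inter_distrib_right, Finset.card_union_of_disjoint
        (hCD.mono Finset.inter_subset_left Finset.inter_subset_left)]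
  rw [hR.delta_eq_s19 (Finset.union_subset_union_left hBD),
    hR.delta_eq_s19 (hBD.trans Finset.subset_union_left : B ⊆ D ∪ C),
    Finset.card_union_of_disjoint (hCD.mono_left hBD)] at hBC
  rw [hR.delta_eq_s19 (A := D ∪ C) (X := D) Finset.subset_union_left, hR.delta_eq_s19 subset_rfl,
    Finset.card_union_of_disjoint hCD] at hDC
  have heq : ((B ∪ C) ∩ ℓ).card - 2 + ((D ∩ ℓ).card - 2) ≥
      ((D ∪ C) ∩ ℓ).card - 2 + ((B ∩ ℓ).card - 2) := by
    by_contra hlt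
    have : ∑ k ∈ linesOf R (D ∪ C), ((((B ∪ C) ∩ k).card - 2 : ℕ) + ((D ∩ k).card - 2 : ℕ) : ℤ) <
        ∑ k ∈ linesOf R (D ∪ C), ((((D ∪ C) ∩ k).card - 2 : ℕ) + ((B ∩ k).card - 2 : ℕ) : ℤ) := by
      refine Finset.sum_lt_sum (fun k _ => ?_) ⟨ℓ, hℓ, by omega⟩
      have := hcard k
      omega
    rw [Finset.sum_add_distrib, Finset.sum_add_distrib] at this
    push_cast at hBC hDC this
    omega
  obtain ⟨h1, h2, h3⟩ := hcard ℓ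
  have h4 : 3 ≤ ((D ∪ C) ∩ ℓ).card := by
    rw [Finset.inter_eq_right.2 (linesOf_subset hℓ)]
    exact (isLineOf_of_mem hℓ).2.1
  have h5 : 0 < (C ∩ ℓ).card := Finset.card_pos.2 (by
    by_contra he
    rw [Finset.not_nonempty_iff_eq_empty] at he
    have : ∀ t ∈ ℓ, t ∈ D := fun t ht => by
      refine (Finset.mem_union.1 (linesOf_subset hℓ ht)).resolve_right fun hc => ?_
      have : t ∈ C ∩ ℓ := Finset.mem_inter.2 ⟨hc, ht⟩
      rw [he] at this
      exact Finset.notMem_empty t this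
    exact hD ⟨this x hxℓ, this y hyℓ, this z hzℓ⟩)
  have h6 : (B ∩ ℓ).card < (D ∩ ℓ).card := by
    by_contra hge
    have he : B ∩ ℓ = D ∩ ℓ := Finset.eq_of_subset_of_card_le
      (Finset.inter_subset_inter_right hBD) (not_lt.1 hge)
    have : ∀ t ∈ ℓ, t ∈ B ∪ C := fun t ht => by
      rcases Finset.mem_union.1 (linesOf_subset hℓ ht) with hd | hc
      · have : t ∈ B ∩ ℓ := he ▸ Finset.mem_inter.2 ⟨hd, ht⟩
        exact Finset.mem_union_left _ (Finset.mem_inter.1 this).1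
      · exact Finset.mem_union_right _ hc
    exact hB ⟨this x hxℓ, this y hyℓ, this z hzℓ⟩
  obtain ⟨b₁, hb₁, b₂, hb₂, hne⟩ := Finset.one_lt_card.1 (show 1 < (B ∩ ℓ).card by omega)
  rw [Finset.mem_inter] at hb₁ hb₂
  have key : ∀ t ∈ ℓ, t = b₁ ∨ t = b₂ ∨ R b₁ b₂ t := fun t ht => by
    by_cases ht₁ : t = b₁
    · exact Or.inl ht₁
    by_cases ht₂ : t = b₂
    · exact Or.inr (Or.inl ht₂)
    exact Or.inr (Or.inr (rel_of_mem_line hℓ hb₁.2 hb₂.2 ht hne (Ne.symm ht₂) (Ne.symm ht₁)))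
  exact ⟨b₁, hb₁.1, b₂, hb₂.1, hne, key x hxℓ, key y hyℓ, key z hzℓ⟩

theorem rel_of_rel_union (hR : IsLinearSpace R) (hR' : IsLinearSpace R') (hBD : B ⊆ D)
    (hCD : Disjoint D C) (hD : RelIsoOn R R' id D) (hB : RelIsoOn R R' id (B ∪ C))
    (hBC : delta R (B ∪ C) ≤ delta R B) (hDC : delta R D ≤ delta R (D ∪ C)) {x y z : M}
    (h : R x y z) (hx : x ∈ D ∪ C) (hy : y ∈ D ∪ C) (hz : z ∈ D ∪ C) : R' x y z := by
  by_cases hxD : x ∈ D ∧ y ∈ D ∧ z ∈ D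
  · exact (hD x hxD.1 y hxD.2.1 z hxD.2.2).1 h
  by_cases hxB : x ∈ B ∪ C ∧ y ∈ B ∪ C ∧ z ∈ B ∪ C
  · exact (hB x hxB.1 y hxB.2.1 z hxB.2.2).1 h
  obtain ⟨b₁, h₁, b₂, h₂, hne, h3, h4, h5⟩ :=
    hR.exists_pair_of_rel hBD hCD hBC hDC h hx hy hz hxD hxB
  have key : ∀ t ∈ D ∪ C, (t = b₁ ∨ t = b₂ ∨ R b₁ b₂ t) → t = b₁ ∨ t = b₂ ∨ R' b₁ b₂ t :=
    fun t ht => Or.imp_right (Or.imp_right fun hr => by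
      rcases Finset.mem_union.1 ht with ht | ht
      · exact (hD b₁ (hBD h₁) b₂ (hBD h₂) t ht).1 hr
      · exact (hB b₁ (Finset.mem_union_left _ h₁) b₂ (Finset.mem_union_left _ h₂) t
          (Finset.mem_union_right _ ht)).1 hr)
  exact hR'.collinear_of_common_pair (key x hx h3) (key y hy h4) (key z hz h5) hne
    (hR.ne12 h) (hR.ne23 h) (hR.ne13 h)

theorem relIsoOn_union (hR : IsLinearSpace R) (hR' : IsLinearSpace R') (hBD : B ⊆ D)
    (hCD : Disjoint D C) (hD : RelIsoOn R R' id D) (hB : RelIsoOn R R' id (B ∪ C))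
    (hBC : delta R (B ∪ C) ≤ delta R B) (hDC : delta R D ≤ delta R (D ∪ C))
    (hDC' : delta R' D ≤ delta R' (D ∪ C)) : RelIsoOn R R' id (D ∪ C) := fun x hx y hy z hz => by
  have hsymm : ∀ {A : Finset M}, RelIsoOn R R' id A → RelIsoOn R' R id A :=
    fun h x hx y hy z hz => (h x hx y hy z hz).symm
  refine ⟨fun h => hR.rel_of_rel_union hR' hBD hCD hD hB hBC hDC h hx hy hz,
    fun h => hR'.rel_of_rel_union hR hBD hCD (hsymm hD) (hsymm hB) ?_ hDC' h hx hy hz⟩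
  rwa [← delta_congr hB, ← delta_congr (hB.mono Finset.subset_union_left)]

end IsLinearSpace

end Extension

section PartialIso

variable {M N : Type*} {RE RF : M → M → M → Prop} {D E F : Finset M}

/-- The relation on `A` induced by `R` along `φ`. -/
def pullbackOn (R : N → N → N → Prop) (φ : M → N) (A : Finset M) : M → M → M → Prop :=
  fun a b c => a ∈ A ∧ b ∈ A ∧ c ∈ A ∧ R (φ a) (φ b) (φ c)

theorem IsLinearSpace.pullbackOn {R : N → N → N → Prop} (hR : IsLinearSpace R) {φ : M → N}
    {A : Finset M} (hφ : Set.InjOn φ A) : IsLinearSpace (pullbackOn R φ A) where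
  ne12 h e := hR.ne12 h.2.2.2 (congrArg φ e)
  ne23 h e := hR.ne23 h.2.2.2 (congrArg φ e)
  ne13 h e := hR.ne13 h.2.2.2 (congrArg φ e)
  swap12 h := ⟨h.2.1, h.1, h.2.2.1, hR.swap12 h.2.2.2⟩
  swap23 h := ⟨h.1, h.2.2.1, h.2.1, hR.swap23 h.2.2.2⟩
  line h h' hne := ⟨h.1, h'.2.2.1, h.2.2.1, hR.line h.2.2.2 h'.2.2.2
    fun e => hne (hφ h.2.2.1 h'.2.2.1 e)⟩

theorem relIsoOn_pullbackOn (R : N → N → N → Prop) (φ : M → N) {A X : Finset M} (hX : X ⊆ A) :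
    RelIsoOn (pullbackOn R φ A) R φ X := fun _ hx _ hy _ hz =>
  ⟨fun h => h.2.2.2, fun h => ⟨hX hx, hX hy, hX hz, h⟩⟩

theorem Strong.of_delta_le {R : M → M → M → Prop} {A A' B : Finset M} (h : Strong R A B)
    (h1 : A ⊆ A') (h2 : A' ⊆ B) (hδ : delta R A' ≤ delta R A) : Strong R A' B :=
  ⟨h2, fun X hX hXB => hδ.trans (h.2 X (h1.trans hX) hXB)⟩

/-- No extension of relative predimension `0` of a base in `D` is realized both in `E \ D` and,
over the image of the base under `h`, in `F \ h(D)`. -/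
def NoCommonExtension (RE RF : M → M → M → Prop) (E F D : Finset M) (h : M → M) : Prop :=
  ∀ (B C : Finset M) (ψ : M → M), B ⊆ D → C ⊆ E \ D → C.Nonempty → (∀ x ∈ B, ψ x = h x) →
    Set.InjOn ψ ↑(B ∪ C) → C.image ψ ⊆ F \ D.image h → RelIsoOn RE RF ψ (B ∪ C) →
    delta RE (B ∪ C) = delta RE B → False

/-- `h` is an isomorphism of a strong subspace `D'` of `E` containing `D` onto a strong subspace
of `F`, and fixes `D` pointwise. -/
structure StrongPartialIso (RE RF : M → M → M → Prop) (D E F D' : Finset M) (h : M → M) :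
    Prop where
  subset : D ⊆ D'
  strong : Strong RE D' E
  injOn : Set.InjOn h D'
  fixes : ∀ x ∈ D, h x = x
  relIsoOn : RelIsoOn RE RF h D'
  strong_image : Strong RF (D'.image h) F

theorem StrongPartialIso.extend (hRE : IsLinearSpace RE) (hRF : IsLinearSpace RF)
    {D' B C : Finset M} {h ψ : M → M} (hs : StrongPartialIso RE RF D E F D' h) (hB : B ⊆ D')
    (hC : C ⊆ E \ D') (hψB : ∀ x ∈ B, ψ x = h x) (hψ : Set.InjOn ψ ↑(B ∪ C))
    (hψC : C.image ψ ⊆ F \ D'.image h) (hiso : RelIsoOn RE RF ψ (B ∪ C))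
    (hδ : delta RE (B ∪ C) = delta RE B) :
    StrongPartialIso RE RF D E F (D' ∪ C) (fun t => if t ∈ D' then h t else ψ t) := by
  set k : M → M := fun t => if t ∈ D' then h t else ψ t with hk
  have hCD : ∀ x ∈ C, x ∉ D' := fun x hx => (Finset.mem_sdiff.1 (hC hx)).2
  have hdis : Disjoint D' C := Finset.disjoint_right.2 hCD
  have hkD : ∀ x ∈ D', k x = h x := fun x hx => if_pos hx
  have hkC : ∀ x ∈ C, k x = ψ x := fun x hx => if_neg (hCD x hx)
  have hkBC : ∀ x ∈ B ∪ C, k x = ψ x := fun x hx => by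
    rcases Finset.mem_union.1 hx with hx | hx
    · rw [hkD x (hB hx), hψB x hx]
    · exact hkC x hx
  have hcross : ∀ x ∈ D', ∀ y ∈ C, k x ≠ k y := fun x hx y hy hxy => by
    rw [hkD x hx, hkC y hy] at hxy
    exact (Finset.mem_sdiff.1 (hψC (Finset.mem_image_of_mem ψ hy))).2
      (hxy ▸ Finset.mem_image_of_mem h hx)
  have hkinj : Set.InjOn k ↑(D' ∪ C) := fun x hx y hy hxy => by
    rcases Finset.mem_union.1 hx with hx | hx <;> rcases Finset.mem_union.1 hy with hy | hy
    · rw [hkD x hx, hkD y hy] at hxy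
      exact hs.injOn hx hy hxy
    · exact (hcross x hx y hy hxy).elim
    · exact (hcross y hy x hx hxy.symm).elim
    · rw [hkC x hx, hkC y hy] at hxy
      exact hψ (Finset.mem_union_right _ hx) (Finset.mem_union_right _ hy) hxy
  have himg : D'.image k = D'.image h := Finset.image_congr hkD
  have hDC : D' ∪ C ⊆ E := Finset.union_subset hs.strong.1 (hC.trans Finset.sdiff_subset)
  have hsub : (D' ∪ C).image k ⊆ F := by
    rw [Finset.image_union, himg, Finset.image_congr (f := k) (g := ψ) hkC]
    exact Finset.union_subset hs.strong_image.1 (hψC.trans Finset.sdiff_subset)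
  have hpull : ∀ X ⊆ D' ∪ C, delta (pullbackOn RF k (D' ∪ C)) X = delta RF (X.image k) :=
    fun X hX => (delta_image (hkinj.mono (by exact_mod_cast hX))
      (relIsoOn_pullbackOn RF k hX)).symm
  have hkiso : RelIsoOn RE RF k (D' ∪ C) := by
    have := hRE.relIsoOn_union (hRF.pullbackOn hkinj) hB hdis (fun x hx y hy z hz => ?_)
      (fun x hx y hy z hz => ?_) hδ.le (hs.strong.2 _ Finset.subset_union_left hDC) ?_
    · exact fun x hx y hy z hz => (this x hx y hy z hz).trans
        (relIsoOn_pullbackOn RF k subset_rfl x hx y hy z hz)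
    · refine Iff.trans ?_ (relIsoOn_pullbackOn RF k Finset.subset_union_left x hx y hy z hz).symm
      rw [hkD x hx, hkD y hy, hkD z hz]
      exact hs.relIsoOn x hx y hy z hz
    · refine Iff.trans ?_ (relIsoOn_pullbackOn RF k (Finset.union_subset_union_left hB)
        x hx y hy z hz).symm
      rw [hkBC x hx, hkBC y hy, hkBC z hz]
      exact hiso x hx y hy z hz
    · rw [hpull _ Finset.subset_union_left, hpull _ subset_rfl, himg]
      exact hs.strong_image.2 _ (himg ▸ Finset.image_subset_image Finset.subset_union_left) hsub
  have hle : delta RE (D' ∪ C) ≤ delta RE D' := by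
    have := hRE.delta_union_le (Z := C) hB (by
      rw [Finset.disjoint_iff_inter_eq_empty.1 hdis]; exact Finset.empty_subset _)
    omega
  refine ⟨hs.subset.trans Finset.subset_union_left,
    hs.strong.of_delta_le Finset.subset_union_left hDC hle, hkinj,
    fun x hx => (hkD x (hs.subset hx)).trans (hs.fixes x hx), hkiso,
    hs.strong_image.of_delta_le
      (himg ▸ Finset.image_subset_image Finset.subset_union_left) hsub ?_⟩
  rw [delta_image hkinj hkiso, delta_image hs.injOn hs.relIsoOn]
  exact hle

theorem exists_strongPartialIso_noCommonExtension (hRE : IsLinearSpace RE)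
    (hRF : IsLinearSpace RF) (hDE : Strong RE D E) (hDF : Strong RF D F)
    (hagree : RelIsoOn RE RF id D) :
    ∃ D' h, StrongPartialIso RE RF D E F D' h ∧ NoCommonExtension RE RF E F D' h := by
  obtain ⟨D', hD', hmax⟩ := Finset.exists_max_image
    (E.powerset.filter fun D' => ∃ h, StrongPartialIso RE RF D E F D' h) Finset.card
    ⟨D, Finset.mem_filter.2 ⟨Finset.mem_powerset.2 hDE.1, id, subset_rfl, hDE, Set.injOn_id _,
      fun _ _ => rfl, hagree, by rwa [Finset.image_id]⟩⟩
  obtain ⟨-, h, hs⟩ := Finset.mem_filter.1 hD'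
  refine ⟨D', h, hs, fun B C ψ hB hC hne hψB hψ hψC hiso hδ => ?_⟩
  have hext := hs.extend hRE hRF hB hC hψB hψ hψC hiso hδ
  have h1 := hmax (D' ∪ C) (Finset.mem_filter.2 ⟨Finset.mem_powerset.2 hext.strong.1, _, hext⟩)
  rw [Finset.card_union_of_disjoint
    (Finset.disjoint_right.2 fun x hx => (Finset.mem_sdiff.1 (hC hx)).2)] at h1
  have := Finset.card_pos.2 hne
  omega

theorem IsLinearSpace.rel_iff_of_mem_triple {R : M → M → M → Prop} (hR : IsLinearSpace R)
    {a b c : M} (h : R a b c) {x y z : M} (hx : x ∈ ({a, b} ∪ {c} : Finset M))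
    (hy : y ∈ ({a, b} ∪ {c} : Finset M)) (hz : z ∈ ({a, b} ∪ {c} : Finset M)) :
    R x y z ↔ x ≠ y ∧ y ≠ z ∧ x ≠ z := by
  have key : ∀ t ∈ ({a, b} ∪ {c} : Finset M), t = a ∨ t = b ∨ R a b t := fun t ht => by
    simp only [Finset.mem_union, Finset.mem_insert, Finset.mem_singleton] at ht
    rcases ht with (rfl | rfl) | rfl
    · exact Or.inl rfl
    · exact Or.inr (Or.inl rfl)
    · exact Or.inr (Or.inr h)
  exact ⟨fun hr => ⟨hR.ne12 hr, hR.ne23 hr, hR.ne13 hr⟩, fun hr =>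
    hR.collinear_of_common_pair (key x hx) (key y hy) (key z hz) (hR.ne12 h) hr.1 hr.2.1 hr.2.2⟩

/-- Lines spanned by two points of `D` do not gain points on both sides. -/
theorem NoCommonExtension.not_rel (hRE : IsLinearSpace RE) (hRF : IsLinearSpace RF) {h : M → M}
    (hno : NoCommonExtension RE RF E F D h) (hDE : Strong RE D E) {a b c d : M} (ha : a ∈ D)
    (hb : b ∈ D) (hc : c ∈ E) (hcD : c ∉ D) (hd : d ∈ F) (hdD : d ∉ D.image h)
    (hE : RE a b c) : ¬ RF (h a) (h b) d := by
  intro hF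
  have hac : a ≠ c := fun e => hcD (e ▸ ha)
  have hbc : b ≠ c := fun e => hcD (e ▸ hb)
  have hcB : c ∉ ({a, b} : Finset M) := by simp [hac.symm, hbc.symm]
  have hBD : ({a, b} : Finset M) ⊆ D := Finset.insert_subset ha (Finset.singleton_subset_iff.2 hb)
  set ψ : M → M := fun t => if t = c then d else h t with hψ
  have hψa : ψ a = h a := if_neg hac
  have hψb : ψ b = h b := if_neg hbc
  have hψc : ψ c = d := if_pos rfl
  have hinj : Set.InjOn ψ ↑({a, b} ∪ {c} : Finset M) := by
    have h1 := hRF.ne12 hF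
    have h2 := hRF.ne13 hF
    have h3 := hRF.ne23 hF
    intro x hx y hy hxy
    simp only [Finset.coe_union, Finset.coe_insert, Finset.coe_singleton, Set.mem_union,
      Set.mem_insert_iff, Set.mem_singleton_iff] at hx hy
    rcases hx with (rfl | rfl) | rfl <;> rcases hy with (rfl | rfl) | rfl <;>
      first
      | rfl
      | (simp only [hψa, hψb, hψc] at hxy
         first
         | exact (h1 hxy).elim
         | exact (h1 hxy.symm).elim
         | exact (h2 hxy).elim
         | exact (h2 hxy.symm).elim
         | exact (h3 hxy).elim
         | exact (h3 hxy.symm).elim)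
  have hmem : ∀ t ∈ ({a, b} ∪ {c} : Finset M), ψ t ∈ ({h a, h b} ∪ {d} : Finset M) := by
    intro t ht
    simp only [Finset.mem_union, Finset.mem_insert, Finset.mem_singleton] at ht ⊢
    rcases ht with (rfl | rfl) | rfl
    · exact Or.inl (Or.inl hψa)
    · exact Or.inl (Or.inr hψb)
    · exact Or.inr hψc
  refine hno {a, b} {c} ψ hBD (by simp [hc, hcD]) (Finset.singleton_nonempty c) ?_ hinj
    (by simpa [hψc, hd] using hdD) ?_ ?_
  · intro x hx
    exact if_neg fun e : x = c => hcB (e ▸ hx)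
  · intro x hx y hy z hz
    rw [hRE.rel_iff_of_mem_triple hE hx hy hz,
      hRF.rel_iff_of_mem_triple hF (hmem x hx) (hmem y hy) (hmem z hz),
      hinj.ne_iff hx hy, hinj.ne_iff hy hz, hinj.ne_iff hx hz]
  · refine le_antisymm
      (hRE.delta_union_singleton_le_of_rel hcB (by simp) (by simp) hE) ?_
    have h1 := hRE.strong_inter_le hDE (X := {a, b} ∪ {c})
      (Finset.union_subset (hBD.trans hDE.1) (Finset.singleton_subset_iff.2 hc))
    rwa [Finset.union_inter_distrib_right, Finset.inter_eq_left.2 hBD,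
      Finset.singleton_inter_of_notMem hcD, Finset.union_empty] at h1

end PartialIso

section Amalgam

theorem isLinearSpace_or {N : Type*} {SE SF : N → N → N → Prop} (hE : IsLinearSpace SE)
    (hF : IsLinearSpace SF) {E F : Finset N} (hsE : ∀ a b c, SE a b c → a ∈ E ∧ b ∈ E ∧ c ∈ E)
    (hsF : ∀ a b c, SF a b c → a ∈ F ∧ b ∈ F ∧ c ∈ F) (hagree : RelIsoOn SE SF id (E ∩ F))
    (hcross : ∀ x ∈ E ∩ F, ∀ y ∈ E ∩ F, ∀ z ∈ E \ F, ∀ w ∈ F \ E, SE x y z → ¬ SF x y w) :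
    IsLinearSpace fun a b c => SE a b c ∨ SF a b c := by
  have toF : ∀ {a b c}, SE a b c → a ∈ F → b ∈ F → c ∈ F → SF a b c := fun h ha hb hc => by
    obtain ⟨h1, h2, h3⟩ := hsE _ _ _ h
    exact (hagree _ (Finset.mem_inter.2 ⟨h1, ha⟩) _ (Finset.mem_inter.2 ⟨h2, hb⟩) _
      (Finset.mem_inter.2 ⟨h3, hc⟩)).1 h
  have toE : ∀ {a b c}, SF a b c → a ∈ E → b ∈ E → c ∈ E → SE a b c := fun h ha hb hc => by
    obtain ⟨h1, h2, h3⟩ := hsF _ _ _ h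
    exact (hagree _ (Finset.mem_inter.2 ⟨ha, h1⟩) _ (Finset.mem_inter.2 ⟨hb, h2⟩) _
      (Finset.mem_inter.2 ⟨hc, h3⟩)).2 h
  have mixed : ∀ {x y z w}, SE x y z → SF x y w → SF x y z ∨ SE x y w := by
    intro x y z w h1 h2
    obtain ⟨hx, hy, hz⟩ := hsE _ _ _ h1
    obtain ⟨hx', hy', hw⟩ := hsF _ _ _ h2
    by_cases hzF : z ∈ F
    · exact Or.inl (toF h1 hx' hy' hzF)
    by_cases hwE : w ∈ E
    · exact Or.inr (toE h2 hx hy hwE)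
    exact (hcross x (Finset.mem_inter.2 ⟨hx, hx'⟩) y (Finset.mem_inter.2 ⟨hy, hy'⟩) z
      (Finset.mem_sdiff.2 ⟨hz, hzF⟩) w (Finset.mem_sdiff.2 ⟨hw, hwE⟩) h1 h2).elim
  refine ⟨fun h => h.elim hE.ne12 hF.ne12, fun h => h.elim hE.ne23 hF.ne23,
    fun h => h.elim hE.ne13 hF.ne13, Or.imp hE.swap12 hF.swap12, Or.imp hE.swap23 hF.swap23, ?_⟩
  rintro x y z w (h1 | h1) (h2 | h2) hne
  · exact Or.inl (hE.line h1 h2 hne)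
  · rcases mixed h1 h2 with h | h
    · exact Or.inr (hF.line h h2 hne)
    · exact Or.inl (hE.line h1 h hne)
  · rcases mixed h2 h1 with h | h
    · exact Or.inr (hF.line h1 h hne)
    · exact Or.inl (hE.line h h2 hne)
  · exact Or.inr (hF.line h1 h2 hne)

theorem injOn_of_leftInverse {M N : Type*} {f : M → N} {fi : N → M} {A : Finset M}
    (h : ∀ x ∈ A, fi (f x) = x) : Set.InjOn f A := fun x hx y hy hxy => by
  rw [← h x hx, ← h y hy, hxy]

theorem injOn_leftInverse {M N : Type*} {f : M → N} {fi : N → M} {A : Finset M}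
    (h : ∀ x ∈ A, fi (f x) = x) : Set.InjOn fi ↑(A.image f) := fun x hx y hy hxy => by
  obtain ⟨a, ha, rfl⟩ := Finset.mem_image.1 hx
  obtain ⟨b, hb, rfl⟩ := Finset.mem_image.1 hy
  rw [h a ha, h b hb] at hxy
  rw [hxy]

theorem image_image_leftInverse {M N : Type*} {f : M → N} {fi : N → M} {A : Finset M}
    (h : ∀ x ∈ A, fi (f x) = x) : (A.image f).image fi = A := by
  rw [Finset.image_image]
  exact (Finset.image_congr (g := id) h).trans Finset.image_id

theorem RelIsoOn.leftInverse {M N : Type*} {R : M → M → M → Prop} {S : N → N → N → Prop}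
    {f : M → N} {fi : N → M} {A : Finset M} (hR : RelIsoOn R S f A)
    (h : ∀ x ∈ A, fi (f x) = x) : RelIsoOn S R fi (A.image f) := fun x hx y hy z hz => by
  obtain ⟨a, ha, rfl⟩ := Finset.mem_image.1 hx
  obtain ⟨b, hb, rfl⟩ := Finset.mem_image.1 hy
  obtain ⟨c, hc, rfl⟩ := Finset.mem_image.1 hz
  rw [h a ha, h b hb, h c hc]
  exact (hR a ha b hb c hc).symm

theorem StrongPartialIso.exists_amalgam {M N : Type u} {RE RF : M → M → M → Prop}
    {D E F D' : Finset M} {h : M → M}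
    {μ : ∀ P : Type u, (P → P → P → Prop) → Finset P → Finset P → ℤ} (hμ : MuInU μ)
    (hRE : IsLinearSpace RE) (hRF : IsLinearSpace RF) (hKE : InKmu μ RE E) (hKF : InKmu μ RF F)
    (hs : StrongPartialIso RE RF D E F D' h) (hno : NoCommonExtension RE RF E F D' h)
    {f g : M → N} {fi gi : N → M} (hf : ∀ x ∈ E, fi (f x) = x) (hg : ∀ x ∈ F, gi (g x) = x)
    (hfg : ∀ x ∈ D', f x = g (h x)) (hne : ∀ x ∈ E, x ∉ D' → ∀ y ∈ F, f x ≠ g y) :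
    ∃ S : N → N → N → Prop, IsLinearSpace S ∧ InKmu μ S (E.image f ∪ F.image g) ∧
      RelIsoOn RE S f E ∧ RelIsoOn RF S g F ∧
      Strong S (E.image f) (E.image f ∪ F.image g) ∧
      Strong S (F.image g) (E.image f ∪ F.image g) := by
  have hDE := hs.strong.1
  have hDF : ∀ x ∈ D', h x ∈ F := fun x hx => hs.strong_image.1 (Finset.mem_image_of_mem h hx)
  have hinter : E.image f ∩ F.image g = D'.image f := by
    ext y
    simp only [Finset.mem_inter, Finset.mem_image]
    constructor
    · rintro ⟨⟨x, hx, rfl⟩, z, hz, hzx⟩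
      by_contra hxD
      exact hne x hx (fun hx' => hxD ⟨x, hx', rfl⟩) z hz hzx.symm
    · rintro ⟨x, hx, rfl⟩
      exact ⟨⟨x, hDE hx, rfl⟩, h x, hDF x hx, (hfg x hx).symm⟩
  have hinter' : E.image f ∩ F.image g = (D'.image h).image g := by
    rw [hinter, Finset.image_image]
    exact Finset.image_congr hfg
  set SE := pullbackOn RE fi (E.image f) with hSE
  set SF := pullbackOn RF gi (F.image g) with hSF
  have hSEl : IsLinearSpace SE := hRE.pullbackOn (injOn_leftInverse hf)
  have hSFl : IsLinearSpace SF := hRF.pullbackOn (injOn_leftInverse hg)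
  have hsE : ∀ a b c, SE a b c → a ∈ E.image f ∧ b ∈ E.image f ∧ c ∈ E.image f :=
    fun a b c hr => ⟨hr.1, hr.2.1, hr.2.2.1⟩
  have hsF : ∀ a b c, SF a b c → a ∈ F.image g ∧ b ∈ F.image g ∧ c ∈ F.image g :=
    fun a b c hr => ⟨hr.1, hr.2.1, hr.2.2.1⟩
  have hSEf : ∀ x ∈ E, ∀ y ∈ E, ∀ z ∈ E, (SE (f x) (f y) (f z) ↔ RE x y z) := by
    intro x hx y hy z hz
    rw [hSE, (relIsoOn_pullbackOn RE fi subset_rfl) _ (Finset.mem_image_of_mem f hx) _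
      (Finset.mem_image_of_mem f hy) _ (Finset.mem_image_of_mem f hz), hf x hx, hf y hy, hf z hz]
  have hSFg : ∀ x ∈ F, ∀ y ∈ F, ∀ z ∈ F, (SF (g x) (g y) (g z) ↔ RF x y z) := by
    intro x hx y hy z hz
    rw [hSF, (relIsoOn_pullbackOn RF gi subset_rfl) _ (Finset.mem_image_of_mem g hx) _
      (Finset.mem_image_of_mem g hy) _ (Finset.mem_image_of_mem g hz), hg x hx, hg y hy, hg z hz]
  have hagree : RelIsoOn SE SF id (E.image f ∩ F.image g) := by
    rw [hinter]
    intro x hx y hy z hz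
    obtain ⟨a, ha, rfl⟩ := Finset.mem_image.1 hx
    obtain ⟨b, hb, rfl⟩ := Finset.mem_image.1 hy
    obtain ⟨c, hc, rfl⟩ := Finset.mem_image.1 hz
    simp only [id]
    rw [hSEf a (hDE ha) b (hDE hb) c (hDE hc), hfg a ha, hfg b hb, hfg c hc,
      hSFg _ (hDF a ha) _ (hDF b hb) _ (hDF c hc)]
    exact hs.relIsoOn a ha b hb c hc
  have hS := isLinearSpace_or hSEl hSFl hsE hsF hagree (by
    rw [hinter]
    intro x hx y hy z hz w hw hxyz hxyw
    obtain ⟨a, ha, rfl⟩ := Finset.mem_image.1 hx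
    obtain ⟨b, hb, rfl⟩ := Finset.mem_image.1 hy
    obtain ⟨hz, hzF⟩ := Finset.mem_sdiff.1 hz
    obtain ⟨hw, hwE⟩ := Finset.mem_sdiff.1 hw
    obtain ⟨c, hc, rfl⟩ := Finset.mem_image.1 hz
    obtain ⟨d, hd, rfl⟩ := Finset.mem_image.1 hw
    rw [hSEf a (hDE ha) b (hDE hb) c hc] at hxyz
    rw [hfg a ha, hfg b hb, hSFg _ (hDF a ha) _ (hDF b hb) d hd] at hxyw
    refine hno.not_rel hRE hRF hs.strong ha hb hc (fun hcD => hzF ?_) hd (fun hdD => hwE ?_)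
      hxyz hxyw
    · rw [hfg c hcD]
      exact Finset.mem_image_of_mem g (hDF c hcD)
    · obtain ⟨t, ht, rfl⟩ := Finset.mem_image.1 hdD
      rw [← hfg t ht]
      exact Finset.mem_image_of_mem f (hDE ht))
  set S : N → N → N → Prop := fun a b c => SE a b c ∨ SF a b c with hSdef
  have hsp : SplitsAs S (E.image f) (F.image g) := fun a b c =>
    Or.imp (hsE a b c) (hsF a b c)
  have hisoE : RelIsoOn RE S f E := fun x hx y hy z hz => by
    have hm := fun t (ht : t ∈ E) => Finset.mem_image_of_mem f ht
    rw [← hSEf x hx y hy z hz]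
    refine ⟨Or.inl, fun hr => hr.elim id fun hr => ?_⟩
    obtain ⟨h1, h2, h3⟩ := hsF _ _ _ hr
    exact (hagree _ (Finset.mem_inter.2 ⟨hm x hx, h1⟩) _ (Finset.mem_inter.2 ⟨hm y hy, h2⟩) _
      (Finset.mem_inter.2 ⟨hm z hz, h3⟩)).2 hr
  have hisoF : RelIsoOn RF S g F := fun x hx y hy z hz => by
    have hm := fun t (ht : t ∈ F) => Finset.mem_image_of_mem g ht
    rw [← hSFg x hx y hy z hz]
    refine ⟨Or.inr, fun hr => hr.elim (fun hr => ?_) id⟩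
    obtain ⟨h1, h2, h3⟩ := hsE _ _ _ hr
    exact (hagree _ (Finset.mem_inter.2 ⟨h1, hm x hx⟩) _ (Finset.mem_inter.2 ⟨h2, hm y hy⟩) _
      (Finset.mem_inter.2 ⟨h3, hm z hz⟩)).1 hr
  have hSE : Strong S (E.image f ∩ F.image g) (E.image f) := by
    rw [hinter]
    exact hs.strong.image (injOn_of_leftInverse hf) hisoE
  have hSF : Strong S (E.image f ∩ F.image g) (F.image g) := by
    rw [hinter']
    exact hs.strong_image.image (injOn_of_leftInverse hg) hisoF
  refine ⟨S, hS, InKmu.union hμ hS hsp hSE hSF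
    (hKE.of_image (injOn_leftInverse hf) (hisoE.leftInverse hf) (image_image_leftInverse hf).le)
    (hKF.of_image (injOn_leftInverse hg) (hisoF.leftInverse hg) (image_image_leftInverse hg).le)
    ?_, hisoE, hisoF, hS.strong_of_splits hsp hSF, ?_⟩
  · intro B C φ hB hC hCne hφB hφinj hφC hφiso hδ
    have hBE : B ⊆ E.image f := hB.trans Finset.inter_subset_left
    rw [hinter] at hB
    obtain ⟨B, hBD, rfl⟩ : ∃ B' ⊆ D', B'.image f = B := by
      obtain ⟨B', h1, h2⟩ := Finset.subset_image_iff.1 hB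
      exact ⟨B', by exact_mod_cast h1, h2⟩
    obtain ⟨C, hCE, rfl⟩ : ∃ C' ⊆ E, C'.image f = C := by
      obtain ⟨C', h1, h2⟩ := Finset.subset_image_iff.1 (hC.trans Finset.sdiff_subset)
      exact ⟨C', by exact_mod_cast h1, h2⟩
    have hU : B ∪ C ⊆ E := Finset.union_subset (hBD.trans hDE) hCE
    have hmem : ∀ x ∈ B ∪ C, f x ∈ B.image f ∪ C.image f := fun x hx =>
      Finset.image_union B C (f := f) ▸ Finset.mem_image_of_mem f hx
    have hφF : ∀ x ∈ B ∪ C, φ (f x) ∈ F.image g := fun x hx => by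
      rcases Finset.mem_union.1 hx with hx | hx
      · rw [hφB _ (Finset.mem_image_of_mem f hx), hfg x (hBD hx)]
        exact Finset.mem_image_of_mem g (hDF x (hBD hx))
      · exact (Finset.mem_sdiff.1 (hφC (Finset.mem_image_of_mem φ
          (Finset.mem_image_of_mem f hx)))).1
    refine hno B C (fun x => gi (φ (f x))) hBD (fun x hx => ?_) (Finset.image_nonempty.1 hCne)
      (fun x hx => ?_) (fun x hx y hy hxy => ?_) (fun y hy => ?_) (fun x hx y hy z hz => ?_) ?_
    · refine Finset.mem_sdiff.2 ⟨hCE hx, fun hxD => ?_⟩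
      refine (Finset.mem_sdiff.1 (hC (Finset.mem_image_of_mem f hx))).2 ?_
      rw [hfg x hxD]
      exact Finset.mem_image_of_mem g (hDF x hxD)
    · rw [hφB _ (Finset.mem_image_of_mem f hx), hfg x (hBD hx), hg _ (hDF x (hBD hx))]
    · exact injOn_of_leftInverse hf (hU hx) (hU hy) (hφinj (hmem x hx) (hmem y hy)
        (injOn_leftInverse hg (hφF x hx) (hφF y hy) hxy))
    · obtain ⟨x, hx, rfl⟩ := Finset.mem_image.1 hy
      obtain ⟨h1, h2⟩ := Finset.mem_sdiff.1 (hφC (Finset.mem_image_of_mem φ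
        (Finset.mem_image_of_mem f hx)))
      obtain ⟨v, hv, hvx⟩ := Finset.mem_image.1 h1
      simp only [← hvx, hg v hv]
      refine Finset.mem_sdiff.2 ⟨hv, fun hvD => h2 ?_⟩
      obtain ⟨t, ht, rfl⟩ := Finset.mem_image.1 hvD
      rw [← hvx, ← hfg t ht]
      exact Finset.mem_image_of_mem f (hDE ht)
    · exact ((hisoE x (hU hx) y (hU hy) z (hU hz)).trans
        (hφiso _ (hmem x hx) _ (hmem y hy) _ (hmem z hz))).trans
        ((hisoF.leftInverse hg) _ (hφF x hx) _ (hφF y hy) _ (hφF z hz))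
    · rw [← Finset.image_union, delta_image_subset (injOn_of_leftInverse hf) hisoE hU,
        delta_image_subset (injOn_of_leftInverse hf) hisoE (hBD.trans hDE)] at hδ
      exact hδ
  · have := hS.strong_of_splits hsp.symm (by rwa [Finset.inter_comm])
    rwa [Finset.union_comm] at this

theorem IsLinearSpace.restrict {N : Type*} {S : N → N → N → Prop} (hS : IsLinearSpace S)
    (G : Finset N) : IsLinearSpace (RestrictLS S G) :=
  hS.pullbackOn (φ := id) (A := G) (Set.injOn_id _)

theorem relIsoOn_restrict {N : Type*} (S : N → N → N → Prop) {A G : Finset N} (hA : A ⊆ G) :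
    RelIsoOn (RestrictLS S G) S id A :=
  relIsoOn_pullbackOn S id hA

theorem strong_restrict_iff {N : Type*} {S : N → N → N → Prop} {A G : Finset N} :
    Strong (RestrictLS S G) A G ↔ Strong S A G := by
  refine and_congr_right fun hA => forall₂_congr fun X hX => forall_congr' fun hXG => ?_
  rw [delta_congr (relIsoOn_restrict S hXG), delta_congr (relIsoOn_restrict S hA)]

end Amalgam

/-- Amalgamation property for `(K_μ, ≤)`: if `D ≤ E` and `D ≤ F` with `D, E, F ∈ K_μ`,
there are `G ∈ K_μ` and strong embeddings of `E` and of `F` into `G` agreeing on `D`. -/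
theorem Kmu_amalgamation
    (μ : ∀ P : Type u, (P → P → P → Prop) → Finset P → Finset P → ℤ) (hμ : MuInU μ)
    (M : Type u) (RE RF : M → M → M → Prop) (D E F : Finset M)
    (hDE0 : D ⊆ E) (hDF0 : D ⊆ F)
    (hE : IsLinearSpace (RestrictLS RE E)) (hF : IsLinearSpace (RestrictLS RF F))
    (hagree : ∀ x ∈ D, ∀ y ∈ D, ∀ z ∈ D, (RE x y z ↔ RF x y z))
    (hKD : InKmu μ RE D) (hKE : InKmu μ RE E) (hKF : InKmu μ RF F)
    (hDE : Strong RE D E) (hDF : Strong RF D F) :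
    ∃ (N : Type u) (S : N → N → N → Prop) (G : Finset N) (f g : M → N),
      IsLinearSpace (RestrictLS S G) ∧ InKmu μ S G ∧
      Set.InjOn f ↑E ∧ E.image f ⊆ G ∧
      (∀ x ∈ E, ∀ y ∈ E, ∀ z ∈ E, (RE x y z ↔ S (f x) (f y) (f z))) ∧
      Strong S (E.image f) G ∧
      Set.InjOn g ↑F ∧ F.image g ⊆ G ∧
      (∀ x ∈ F, ∀ y ∈ F, ∀ z ∈ F, (RF x y z ↔ S (g x) (g y) (g z))) ∧
      Strong S (F.image g) G ∧
      (∀ x ∈ D, f x = g x) := by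
  classical
  have hRE : RelIsoOn (RestrictLS RE E) RE id E := relIsoOn_restrict RE subset_rfl
  have hRF : RelIsoOn (RestrictLS RF F) RF id F := relIsoOn_restrict RF subset_rfl
  obtain ⟨D', h, hs, hno⟩ := exists_strongPartialIso_noCommonExtension hE hF
    (strong_restrict_iff.2 hDE) (strong_restrict_iff.2 hDF) (fun x hx y hy z hz =>
      (hRE x (hDE0 hx) y (hDE0 hy) z (hDE0 hz)).trans ((hagree x hx y hy z hz).trans
        (hRF x (hDF0 hx) y (hDF0 hy) z (hDF0 hz)).symm))
  have hinv : ∀ x ∈ D', Function.extend (fun t : D' => h t) Subtype.val id (h x) = x :=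
    fun x hx => (Set.injOn_iff_injective.1 hs.injOn).extend_apply _ _ (⟨x, hx⟩ : D')
  set f : M → M ⊕ M := fun x => if x ∈ D' then Sum.inr (h x) else Sum.inl x
  have hfD : ∀ x ∈ D', f x = Sum.inr (h x) := fun x hx => if_pos hx
  have hfE : ∀ x, x ∉ D' → f x = Sum.inl x := fun x hx => if_neg hx
  have hf : ∀ x ∈ E, Sum.elim id (Function.extend (fun t : D' => h t) Subtype.val id) (f x) = x :=
    fun x _ => by
      by_cases hx : x ∈ D'
      · rw [hfD x hx]
        exact hinv x hx
      · rw [hfE x hx]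
        rfl
  have hg : ∀ x ∈ F, Sum.elim (id : M → M) id (Sum.inr x) = x := fun x _ => rfl
  obtain ⟨S, hS, hK, hisoE, hisoF, hSE, hSF⟩ := hs.exists_amalgam hμ hE hF
    (hKE.of_image (Set.injOn_id _) hRE Finset.image_id.le)
    (hKF.of_image (Set.injOn_id _) hRF Finset.image_id.le) hno hf hg hfD
    (fun x _ hx y _ => by rw [hfE x hx]; exact Sum.inl_ne_inr)
  refine ⟨M ⊕ M, S, E.image f ∪ F.image Sum.inr, f, Sum.inr, hS.restrict _, ?_,
    injOn_of_leftInverse hf, ?_, fun x hx y hy z hz =>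
      (hRE x hx y hy z hz).symm.trans (hisoE x hx y hy z hz), ?_,
    Sum.inr_injective.injOn, ?_, fun x hx y hy z hz =>
      (hRF x hx y hy z hz).symm.trans (hisoF x hx y hy z hz), ?_, fun x hx => ?_⟩
  · convert hK
  · convert hSE.1
  · convert hSE
  · convert hSF.1
  · convert hSF
  · rw [hfD x (hs.subset hx), hs.fixes x hx]
end
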